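/- Let A be a continuous linear cocycle over a continuous discrete-time dynamical system Ψ on a compact metric space X, with values in GL(n,ℝ). For any natural number N, define V(x) := Q(x)^{-1/2} where Q(x) := bar(I, A⁽¹⁾(x)^{-1} ∗ I, …, A⁽ᴺ⁻¹⁾(x)^{-1} ∗ I) is the unweighted barycenter in the trace metric (and g ∗ p := g p gᵀ). Then the conjugate cocycle with generator ℬ(x) := V(Ψ(x)) 𝒜(x) V(x)^{-1} is continuous and satisfies σ⃗(ℬ(x)) ⪯ N^{-1} σ⃗(A⁽ᴺ⁾(x)) for all x ∈ X. -/

import Mathlib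

open Matrix

noncomputable section

variable {n : ℕ}

/-- The `t`-th power of a symmetric matrix, defined via the spectral decomposition
(junk value if the matrix is not symmetric). -/
noncomputable def mpow (A : Matrix (Fin n) (Fin n) ℝ) (t : ℝ) : Matrix (Fin n) (Fin n) ℝ :=
  if h : A.IsHermitian then
    (h.eigenvectorUnitary : Matrix (Fin n) (Fin n) ℝ) *
      Matrix.diagonal (fun i => (h.eigenvalues i) ^ t) *
      (star (h.eigenvectorUnitary : Matrix (Fin n) (Fin n) ℝ))
  else A

/-- Eigenvalues of a symmetric matrix, listed in nonincreasing order
(junk value `0` if the matrix is not symmetric). -/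
noncomputable def eigsDesc (A : Matrix (Fin n) (Fin n) ℝ) : Fin n → ℝ :=
  if h : A.IsHermitian then fun i => h.eigenvalues (Tuple.sort h.eigenvalues i.rev) else 0

/-- Singular values of a square real matrix, in nonincreasing order. -/
noncomputable def svals (g : Matrix (Fin n) (Fin n) ℝ) : Fin n → ℝ :=
  fun i => Real.sqrt (eigsDesc (gᵀ * g) i)

/-- The vector `σ⃗(g)` of base-2 logarithms of the singular values of `g`,
in nonincreasing order. -/
noncomputable def sigmaVec (g : Matrix (Fin n) (Fin n) ℝ) : Fin n → ℝ :=
  fun i => Real.logb 2 (svals g i)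

/-- The vectorial distance `d⃗(p,q) = 2 σ⃗(p^{-1/2} q^{1/2})`. -/
noncomputable def vecd (p q : Matrix (Fin n) (Fin n) ℝ) : Fin n → ℝ :=
  fun i => 2 * sigmaVec (mpow p (-(1/2)) * mpow q (1/2)) i

/-- Partial sum of the first `k` components of a vector in `ℝⁿ`. -/
noncomputable def psum (ξ : Fin n → ℝ) (k : ℕ) : ℝ :=
  ∑ i ∈ Finset.univ.filter (fun i : Fin n => (i : ℕ) < k), ξ i

/-- The majorization-type partial order `⪯` on `ℝⁿ`: all partial sums are compared,
with equality of the total sums. -/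
def maj (ξ η : Fin n → ℝ) : Prop :=
  (∀ k : ℕ, k < n → psum ξ k ≤ psum η k) ∧ psum ξ n = psum η n

/-- The geodesic `p #_t q = p^{1/2} (p^{-1/2} q p^{-1/2})^t p^{1/2}` in the trace metric
on positive definite matrices. -/
noncomputable def geo (p q : Matrix (Fin n) (Fin n) ℝ) (t : ℝ) : Matrix (Fin n) (Fin n) ℝ :=
  mpow p (1/2) * mpow (mpow p (-(1/2)) * q * mpow p (-(1/2))) t * mpow p (1/2)

/-- The Riemannian (trace-metric) distance on positive definite matrices, expressed as the
Euclidean norm of the vector of base-2 logarithms of the eigenvalues of `p^{-1/2} q p^{-1/2}`. -/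
noncomputable def rdist (p q : Matrix (Fin n) (Fin n) ℝ) : ℝ :=
  Real.sqrt (∑ i : Fin n,
    (Real.logb 2 (eigsDesc (mpow p (-(1/2)) * q * mpow p (-(1/2))) i)) ^ 2)


section Part1
open scoped MatrixOrder ComplexOrder
set_option linter.unusedSectionVars false

theorem cfc_udu_gen {𝕜 ι : Type*} [RCLike 𝕜] [Fintype ι] [DecidableEq ι]
    (U : Matrix ι ι 𝕜) (hU : U * star U = 1) (d : ι → ℝ) (f : ℝ → ℝ) :
    cfc f (U * diagonal (fun i => (d i : 𝕜)) * star U)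
      = U * diagonal (fun i => (f (d i) : 𝕜)) * star U := by
  have hU' : star U * U = 1 := mul_eq_one_comm.mp hU
  have hA : (U * diagonal (fun i => (d i : 𝕜)) * star U).IsHermitian := by
    have : (diagonal (fun i => (d i : 𝕜))).IsHermitian := by
      rw [Matrix.isHermitian_diagonal_iff]
      intro i
      exact RCLike.conj_ofReal _
    exact Matrix.isHermitian_mul_mul_conjTranspose U this
  rw [hA.cfc_eq, Matrix.IsHermitian.cfc, Unitary.conjStarAlgAut_apply]
  have hsp := hA.spectral_theorem
  rw [Unitary.conjStarAlgAut_apply] at hsp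
  set V : Matrix ι ι 𝕜 := (hA.eigenvectorUnitary : Matrix ι ι 𝕜) with hV
  set e := hA.eigenvalues with he
  have hVV : V * star V = 1 := Unitary.coe_mul_star_self hA.eigenvectorUnitary
  have hVV' : star V * V = 1 := Unitary.coe_star_mul_self hA.eigenvectorUnitary
  have hW : (star V * U) * diagonal (fun i => (d i : 𝕜))
      = diagonal (RCLike.ofReal ∘ e) * (star V * U) := by
    calc (star V * U) * diagonal (fun i => (d i : 𝕜))
        = star V * (U * diagonal (fun i => (d i : 𝕜)) * star U) * U := by
          simp only [mul_assoc, hU', mul_one]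
      _ = star V * (V * diagonal (RCLike.ofReal ∘ e) * star V) * U := by rw [hsp]
      _ = (star V * V) * diagonal (RCLike.ofReal ∘ e) * (star V * U) := by
          simp only [mul_assoc]
      _ = _ := by rw [hVV', one_mul]
  have hWf : (star V * U) * diagonal (fun i => (f (d i) : 𝕜))
      = diagonal (RCLike.ofReal ∘ f ∘ e) * (star V * U) := by
    ext i j
    have h := congrFun (congrFun hW i) j
    rw [mul_diagonal, diagonal_mul] at h ⊢
    by_cases h0 : (star V * U) i j = 0
    · simp [h0]
    · have h1 : (d j : 𝕜) = (e i : 𝕜) := by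
        have := mul_left_cancel₀ h0 (h.trans (mul_comm _ _))
        simpa using this
      have h2 : d j = e i := by exact_mod_cast h1
      simp [h2, mul_comm]
  calc V * diagonal (RCLike.ofReal ∘ f ∘ e) * star V
      = V * (diagonal (RCLike.ofReal ∘ f ∘ e) * (star V * U)) * star U := by
        simp only [mul_assoc, hU, mul_one]
    _ = V * ((star V * U) * diagonal (fun i => (f (d i) : 𝕜))) * star U := by rw [hWf]
    _ = (V * star V) * U * diagonal (fun i => (f (d i) : 𝕜)) * star U := by
        simp only [mul_assoc]
    _ = _ := by rw [hVV, one_mul]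

variable {ι : Type*} [Fintype ι] [DecidableEq ι]

theorem cfc_udu (U : Matrix ι ι ℝ) (hU : U * Uᵀ = 1) (d : ι → ℝ) (f : ℝ → ℝ) :
    cfc f (U * diagonal d * Uᵀ) = U * diagonal (fun i => f (d i)) * Uᵀ := by
  have := cfc_udu_gen (𝕜 := ℝ) U (by simpa [star_eq_conjTranspose] using hU) d f
  simpa [star_eq_conjTranspose] using this

theorem exists_udu {A : Matrix ι ι ℝ} (hA : A.IsHermitian) :
    ∃ (U : Matrix ι ι ℝ), U * Uᵀ = 1 ∧ Uᵀ * U = 1 ∧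
      A = U * diagonal hA.eigenvalues * Uᵀ := by
  have hsp := hA.spectral_theorem
  rw [Unitary.conjStarAlgAut_apply] at hsp
  have h1 : (hA.eigenvectorUnitary : Matrix ι ι ℝ) * star (hA.eigenvectorUnitary : Matrix ι ι ℝ)
      = 1 := Unitary.coe_mul_star_self hA.eigenvectorUnitary
  have h2 := Unitary.coe_star_mul_self hA.eigenvectorUnitary
  rw [star_eq_conjTranspose, conjTranspose_eq_transpose_of_trivial] at h1 h2 hsp
  refine ⟨_, h1, h2, ?_⟩
  conv_lhs => rw [hsp]
  rfl

theorem quad_udu (U : Matrix ι ι ℝ) (d : ι → ℝ) (v : ι → ℝ) :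
    v ⬝ᵥ (U * diagonal d * Uᵀ) *ᵥ v = ∑ i, d i * ((Uᵀ *ᵥ v) i) ^ 2 := by
  rw [← mulVec_mulVec, ← mulVec_mulVec, dotProduct_mulVec, ← mulVec_transpose]
  simp only [dotProduct, mulVec_diagonal]
  refine Finset.sum_congr rfl fun i _ => by ring

theorem herm_iff {A : Matrix ι ι ℝ} : A.IsHermitian ↔ Aᵀ = A := by
  rw [Matrix.IsHermitian, conjTranspose_eq_transpose_of_trivial]

theorem herm_udu (U : Matrix ι ι ℝ) (d : ι → ℝ) : (U * diagonal d * Uᵀ).IsHermitian := by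
  rw [herm_iff]; simp [mul_assoc]

theorem herm_conj {A : Matrix ι ι ℝ} (hA : A.IsHermitian) (C : Matrix ι ι ℝ) :
    (C * A * Cᵀ).IsHermitian := by
  rw [herm_iff] at *; simp [mul_assoc, hA]

theorem psd_iff {A : Matrix ι ι ℝ} :
    A.PosSemidef ↔ A.IsHermitian ∧ ∀ v, 0 ≤ v ⬝ᵥ A *ᵥ v := by
  rw [posSemidef_iff_dotProduct_mulVec]; simp

theorem le_iff_quad {A B : Matrix ι ι ℝ} (hA : A.IsHermitian) (hB : B.IsHermitian) :
    A ≤ B ↔ ∀ v, v ⬝ᵥ A *ᵥ v ≤ v ⬝ᵥ B *ᵥ v := by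
  rw [Matrix.le_iff, psd_iff]
  simp only [sub_mulVec, dotProduct_sub, sub_nonneg]
  exact ⟨fun h => h.2, fun h => ⟨hB.sub hA, h⟩⟩

theorem quad_le {A B : Matrix ι ι ℝ} (h : A ≤ B) (v : ι → ℝ) :
    v ⬝ᵥ A *ᵥ v ≤ v ⬝ᵥ B *ᵥ v := by
  rw [Matrix.le_iff, psd_iff] at h
  have := h.2 v
  rw [sub_mulVec, dotProduct_sub] at this
  linarith

theorem conj_le {A B : Matrix ι ι ℝ} (h : A ≤ B) (C : Matrix ι ι ℝ) :
    C * A * Cᵀ ≤ C * B * Cᵀ := by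
  rw [Matrix.le_iff] at *
  have := h.mul_mul_conjTranspose_same C
  rw [conjTranspose_eq_transpose_of_trivial] at this
  rwa [mul_sub, sub_mul] at this

theorem psd_complex {A : Matrix ι ι ℝ} :
    (A.map (fun x => (x : ℂ))).PosSemidef ↔ A.PosSemidef := by
  constructor
  · intro h
    rw [psd_iff]
    constructor
    · have := h.1
      ext i j
      have h1 := congrFun (congrFun this i) j
      simp only [conjTranspose_apply, map_apply] at h1 ⊢
      simpa using h1
    · intro v
      have := h.dotProduct_mulVec_nonneg (fun i => (v i : ℂ))
      have h2 : star (fun i => (v i : ℂ)) ⬝ᵥ (A.map (fun x => (x : ℂ))) *ᵥ (fun i => (v i : ℂ))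
          = ((v ⬝ᵥ A *ᵥ v : ℝ) : ℂ) := by
        simp [dotProduct, mulVec]
      rw [h2] at this
      exact_mod_cast this
  · intro h
    obtain ⟨U, h1, h2, h3⟩ := exists_udu h.1
    have hd := h.eigenvalues_nonneg
    have : A.map (fun x => (x : ℂ)) = (U.map (fun x => (x : ℂ))) *
        (diagonal (fun i => ((h.1.eigenvalues i : ℝ) : ℂ))) * (U.map (fun x => (x : ℂ)))ᴴ := by
      conv_lhs => rw [h3]
      have e1 : ∀ M N : Matrix ι ι ℝ, (M * N).map (fun x => (x : ℂ)) =
        M.map (fun x => (x : ℂ)) * N.map (fun x => (x : ℂ)) := fun M N =>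
          Matrix.map_mul (f := Complex.ofRealHom)
      rw [e1, e1]
      congr 1
      · congr 1
        rw [diagonal_map (by simp)]
      · ext i j; simp
    rw [this]
    apply PosSemidef.mul_mul_conjTranspose_same
    apply PosSemidef.diagonal
    intro i
    simpa using hd i

theorem map_udu_cfc (A : Matrix ι ι ℝ) (hA : A.IsHermitian) (f : ℝ → ℝ) :
    (cfc f A).map (fun x => (x : ℂ)) = cfc f (A.map (fun x => (x : ℂ))) := by
  obtain ⟨U, h1, h2, h3⟩ := exists_udu hA
  have e1 : ∀ M N : Matrix ι ι ℝ, (M * N).map (fun x => (x : ℂ)) =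
        M.map (fun x => (x : ℂ)) * N.map (fun x => (x : ℂ)) := fun M N =>
          Matrix.map_mul (f := Complex.ofRealHom)
  have e2 : ∀ d : ι → ℝ, (U * diagonal d * Uᵀ).map (fun x => (x : ℂ)) =
      (U.map (fun x => (x : ℂ))) *
        (diagonal (fun i => ((d i : ℝ) : ℂ))) * star (U.map (fun x => (x : ℂ))) := by
    intro d
    rw [e1, e1]
    congr 1
    · congr 1
      rw [diagonal_map (by simp)]
    · ext i j; simp
  have hUc : (U.map (fun x => (x : ℂ))) * star (U.map (fun x => (x : ℂ))) = 1 := by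
    have := congrArg (fun M : Matrix ι ι ℝ => M.map (fun x => (x : ℂ))) h1
    simp only [e1] at this
    rw [Matrix.map_one _ (by simp) (by simp)] at this
    rw [← this]; congr 1; ext i j; simp
  rw [h3, cfc_udu U h1, e2, e2]
  have := cfc_udu_gen (𝕜 := ℂ) _ hUc hA.eigenvalues f
  exact this.symm

theorem rpow_mono_cplx {a b : Matrix ι ι ℂ} (ha : 0 ≤ a) (h : a ≤ b) {p : ℝ}
    (hp : p ∈ Set.Icc (0 : ℝ) 1) :
    cfc (fun x : ℝ => x ^ p) a ≤ cfc (fun x : ℝ => x ^ p) b := by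
  rw [← CFC.rpow_eq_cfc_real ha, ← CFC.rpow_eq_cfc_real (ha.trans h)]
  open scoped Matrix.Norms.L2Operator in
  exact CFC.rpow_le_rpow hp h

theorem rpow_mono {A B : Matrix ι ι ℝ} (hA : A.PosSemidef) (h : A ≤ B) {p : ℝ}
    (hp : p ∈ Set.Icc (0 : ℝ) 1) :
    cfc (fun x : ℝ => x ^ p) A ≤ cfc (fun x : ℝ => x ^ p) B := by
  have hB : B.PosSemidef := by
    have : 0 ≤ B := le_trans hA.nonneg h
    exact this.posSemidef
  have e3 : ∀ M N : Matrix ι ι ℝ, (M - N).map (fun x => (x : ℂ)) =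
        M.map (fun x => (x : ℂ)) - N.map (fun x => (x : ℂ)) := fun M N => by
          ext i j; simp
  rw [Matrix.le_iff, ← psd_complex, e3, map_udu_cfc _ hA.1, map_udu_cfc _ hB.1, ← Matrix.le_iff]
  apply rpow_mono_cplx _ _ hp
  · exact (psd_complex.2 hA).nonneg
  · rw [Matrix.le_iff, ← e3]; exact psd_complex.2 h

theorem quad_tendsto {A : Matrix ι ι ℝ} (hA : A.IsHermitian) (v : ι → ℝ) {l : Filter ℝ}
    (F : ℝ → ℝ → ℝ) (f : ℝ → ℝ)
    (h : ∀ i, Filter.Tendsto (fun s => F s (hA.eigenvalues i)) l (nhds (f (hA.eigenvalues i)))) :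
    Filter.Tendsto (fun s => v ⬝ᵥ (cfc (F s) A) *ᵥ v) l (nhds (v ⬝ᵥ (cfc f A) *ᵥ v)) := by
  obtain ⟨U, h1, h2, h3⟩ := exists_udu hA
  have : ∀ g : ℝ → ℝ, v ⬝ᵥ (cfc g A) *ᵥ v
      = ∑ i, g (hA.eigenvalues i) * ((Uᵀ *ᵥ v) i) ^ 2 := by
    intro g
    conv_lhs => rw [h3]
    rw [cfc_udu U h1, quad_udu]
  simp only [this]
  exact tendsto_finsetSum _ fun i _ => (h i).mul_const _

theorem tendsto_rpow_log {t : ℝ} (ht : 0 < t) :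
    Filter.Tendsto (fun s : ℝ => s⁻¹ * (t ^ s - 1)) (nhdsWithin 0 (Set.Ioi 0))
      (nhds (Real.log t)) := by
  have h : HasDerivAt (fun s : ℝ => t ^ s) (Real.log t) 0 := by
    have := (hasDerivAt_id (0 : ℝ)).const_rpow ht
    simpa using this
  have := h.tendsto_slope_zero_right
  simpa using this

theorem quad_rpow (A : Matrix ι ι ℝ) (hA : A.IsHermitian) (v : ι → ℝ) (a b c p : ℝ) :
    v ⬝ᵥ (cfc (fun x : ℝ => a * x ^ p + b * x + c) A) *ᵥ v
      = a * (v ⬝ᵥ (cfc (fun x : ℝ => x ^ p) A) *ᵥ v) + b * (v ⬝ᵥ A *ᵥ v) + c * (v ⬝ᵥ v) := by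
  obtain ⟨U, h1, h2, h3⟩ := exists_udu hA
  have hv : v ⬝ᵥ v = ∑ i, 1 * ((Uᵀ *ᵥ v) i) ^ 2 := by
    rw [← quad_udu U (fun _ => 1) v]
    simp [h1]
  conv_lhs => rw [h3]
  conv_rhs => rw [h3, hv]
  rw [cfc_udu U h1, cfc_udu U h1, quad_udu, quad_udu, quad_udu]
  simp only [Finset.mul_sum]
  rw [← Finset.sum_add_distrib, ← Finset.sum_add_distrib]
  exact Finset.sum_congr rfl fun i _ => by ring

theorem log_mono {A B : Matrix ι ι ℝ} (hA : A.PosDef) (hB : B.PosDef) (h : A ≤ B) (v : ι → ℝ) :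
    v ⬝ᵥ (cfc Real.log A) *ᵥ v ≤ v ⬝ᵥ (cfc Real.log B) *ᵥ v := by
  have key : ∀ {C : Matrix ι ι ℝ} (hC : C.PosDef),
      Filter.Tendsto (fun s : ℝ => v ⬝ᵥ (cfc (fun x : ℝ => s⁻¹ * x ^ s + 0 * x + (-s⁻¹)) C) *ᵥ v)
        (nhdsWithin 0 (Set.Ioi 0)) (nhds (v ⬝ᵥ (cfc Real.log C) *ᵥ v)) := by
    intro C hC
    apply quad_tendsto hC.1
    intro i
    have := tendsto_rpow_log (hC.eigenvalues_pos i)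
    refine this.congr fun s => by ring
  refine le_of_tendsto_of_tendsto (key hA) (key hB) ?_
  have h1 : ∀ᶠ s : ℝ in nhdsWithin 0 (Set.Ioi 0), s ∈ Set.Ioo (0 : ℝ) 1 :=
    Ioo_mem_nhdsGT one_pos
  filter_upwards [h1] with s hs
  rw [quad_rpow _ hA.1, quad_rpow _ hB.1]
  have := quad_le (rpow_mono hA.posSemidef h ⟨hs.1.le, hs.2.le⟩) v
  have h2 : 0 < s⁻¹ := inv_pos.2 hs.1
  nlinarith [mul_le_mul_of_nonneg_left this h2.le]

theorem eta_touch {A B : Matrix ι ι ℝ} (hA : A.PosDef) (hB : B.PosDef) (h : A ≤ B) (v : ι → ℝ)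
    (hv : A *ᵥ v = B *ᵥ v) :
    v ⬝ᵥ (cfc (fun x => x * Real.log x) B) *ᵥ v ≤ v ⬝ᵥ (cfc (fun x => x * Real.log x) A) *ᵥ v := by
  have key : ∀ {C : Matrix ι ι ℝ} (hC : C.PosDef),
      Filter.Tendsto (fun s : ℝ => v ⬝ᵥ (cfc (fun x : ℝ => (-s⁻¹) * x ^ (1 - s) + s⁻¹ * x + 0) C) *ᵥ v)
        (nhdsWithin 0 (Set.Ioi 0)) (nhds (v ⬝ᵥ (cfc (fun x => x * Real.log x) C) *ᵥ v)) := by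
    intro C hC
    apply quad_tendsto hC.1
    intro i
    have hpos := hC.eigenvalues_pos i
    have := (tendsto_rpow_log (inv_pos.2 hpos)).const_mul (-hC.1.eigenvalues i)
    rw [Real.log_inv] at this
    have h2 : -hC.1.eigenvalues i * -Real.log (hC.1.eigenvalues i)
      = hC.1.eigenvalues i * Real.log (hC.1.eigenvalues i) := by ring
    rw [h2] at this
    refine this.congr fun s => ?_
    rw [Real.rpow_sub hpos, Real.rpow_one, Real.inv_rpow hpos.le]
    field_simp
    ring
  refine le_of_tendsto_of_tendsto (key hB) (key hA) ?_
  have h1 : ∀ᶠ s : ℝ in nhdsWithin 0 (Set.Ioi 0), s ∈ Set.Ioo (0 : ℝ) 1 :=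
    Ioo_mem_nhdsGT one_pos
  filter_upwards [h1] with s hs
  rw [quad_rpow _ hA.1, quad_rpow _ hB.1, hv]
  have := quad_le (rpow_mono hA.posSemidef h (p := 1 - s)
    ⟨by linarith [hs.2], by linarith [hs.1]⟩) v
  have h2 : 0 < s⁻¹ := inv_pos.2 hs.1
  nlinarith [mul_le_mul_of_nonneg_left this h2.le]

end Part1
section Part2
open scoped MatrixOrder ComplexOrder
set_option linter.unusedSectionVars false
variable {ι : Type*} [Fintype ι] [DecidableEq ι]

theorem pd_conj {P : Matrix ι ι ℝ} (hP : P.PosDef) {g : Matrix ι ι ℝ} (hg : IsUnit g) :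
    (g * P * gᵀ).PosDef := by
  have := (IsUnit.posDef_star_right_conjugate_iff (x := P) hg).2 hP
  rwa [star_eq_conjTranspose, conjTranspose_eq_transpose_of_trivial] at this

theorem pd_mul_transpose {g : Matrix ι ι ℝ} (hg : IsUnit g) : (g * gᵀ).PosDef := by
  have := pd_conj (PosDef.one (n := ι) (R := ℝ)) hg
  rwa [mul_one] at this

theorem unit_inv_mul {g : Matrix ι ι ℝ} (hg : IsUnit g) : g⁻¹ * g = 1 :=
  nonsing_inv_mul g ((Matrix.isUnit_iff_isUnit_det g).1 hg)

theorem unit_mul_inv {g : Matrix ι ι ℝ} (hg : IsUnit g) : g * g⁻¹ = 1 :=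
  mul_nonsing_inv g ((Matrix.isUnit_iff_isUnit_det g).1 hg)

theorem unit_inv {g : Matrix ι ι ℝ} (hg : IsUnit g) : IsUnit g⁻¹ :=
  IsUnit.of_mul_eq_one _ (unit_inv_mul hg)

theorem unit_transpose {g : Matrix ι ι ℝ} (hg : IsUnit g) : IsUnit gᵀ := by
  rw [Matrix.isUnit_iff_isUnit_det] at *
  rwa [det_transpose]

theorem exists_factor {P : Matrix ι ι ℝ} (hP : P.PosDef) :
    ∃ p : Matrix ι ι ℝ, IsUnit p ∧ P = p * pᵀ := by
  obtain ⟨U, h1, h2, h3⟩ := exists_udu hP.1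
  have hd := hP.eigenvalues_pos
  refine ⟨U * diagonal (fun i => Real.sqrt (hP.1.eigenvalues i)), ?_, ?_⟩
  · apply IsUnit.mul
    · exact IsUnit.of_mul_eq_one _ h1
    · rw [Matrix.isUnit_iff_isUnit_det, det_diagonal, isUnit_iff_ne_zero, Finset.prod_ne_zero_iff]
      intro i _
      exact (Real.sqrt_pos.2 (hd i)).ne'
  · conv_lhs => rw [h3]
    rw [transpose_mul, diagonal_transpose]
    have : diagonal hP.1.eigenvalues = diagonal (fun i => Real.sqrt (hP.1.eigenvalues i)) *
        diagonal (fun i => Real.sqrt (hP.1.eigenvalues i)) := by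
      rw [diagonal_mul_diagonal]
      congr 1; ext i; exact (Real.mul_self_sqrt (hd i).le).symm
    conv_lhs => rw [this]
    simp only [mul_assoc]

theorem entropy_swap {g p : Matrix ι ι ℝ} (hg : IsUnit g) (hp : IsUnit p) :
    g * cfc Real.log (g⁻¹ * (p * pᵀ) * (g⁻¹)ᵀ) * gᵀ
      = -(p * cfc (fun x => x * Real.log x) (p⁻¹ * (g * gᵀ) * (p⁻¹)ᵀ) * pᵀ) := by
  have hpd : (p⁻¹ * (g * gᵀ) * (p⁻¹)ᵀ).PosDef := pd_conj (pd_mul_transpose hg) (unit_inv hp)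
  obtain ⟨U, h1, h2, h3⟩ := exists_udu hpd.1
  have hd := hpd.eigenvalues_pos
  set d := hpd.1.eigenvalues with hdd
  set j := p⁻¹ * g with hj
  have hju : IsUnit j := (unit_inv hp).mul hg
  have hjj : j * jᵀ = U * diagonal d * Uᵀ := by
    rw [← h3, hj]; simp only [transpose_mul, mul_assoc]
  have hgj : g = p * j := by rw [hj, ← mul_assoc, unit_mul_inv hp, one_mul]
  set r : ι → ℝ := fun i => Real.sqrt (d i) with hr
  have hrp : ∀ i, 0 < r i := fun i => Real.sqrt_pos.2 (hd i)
  have hrr : ∀ i, d i = r i * r i := fun i => (Real.mul_self_sqrt (hd i).le).symm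
  set W := jᵀ * U * diagonal (fun i => (r i)⁻¹) with hW
  have hWt : Wᵀ = diagonal (fun i => (r i)⁻¹) * Uᵀ * j := by
    simp [hW, mul_assoc]
  have hjW : j * W = U * diagonal r := by
    calc j * W = (j * jᵀ) * U * diagonal (fun i => (r i)⁻¹) := by simp only [hW, mul_assoc]
      _ = U * diagonal d * (Uᵀ * U) * diagonal (fun i => (r i)⁻¹) := by
        rw [hjj]; simp only [mul_assoc]
      _ = _ := by
        rw [h2, mul_one, mul_assoc, diagonal_mul_diagonal]
        congr 2; ext i; rw [hrr i]; field_simp [(hrp i).ne']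
  have hWW : Wᵀ * W = 1 := by
    rw [hWt, mul_assoc, hjW]
    calc diagonal (fun i => (r i)⁻¹) * Uᵀ * (U * diagonal r)
        = diagonal (fun i => (r i)⁻¹) * (Uᵀ * U) * diagonal r := by simp only [mul_assoc]
      _ = 1 := by
        rw [h2, mul_one, diagonal_mul_diagonal, ← diagonal_one]
        congr 1; ext i; exact inv_mul_cancel₀ (hrp i).ne'
  have hWW' : W * Wᵀ = 1 := mul_eq_one_comm.mp hWW
  have hinv : g⁻¹ * (p * pᵀ) * (g⁻¹)ᵀ = W * diagonal (fun i => (d i)⁻¹) * Wᵀ := by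
    have e1 : j * (W * diagonal (fun i => (d i)⁻¹) * Wᵀ) * jᵀ = 1 := by
      calc j * (W * diagonal (fun i => (d i)⁻¹) * Wᵀ) * jᵀ
          = (j * W) * diagonal (fun i => (d i)⁻¹) * (j * W)ᵀ := by
            simp only [transpose_mul, mul_assoc]
        _ = U * (diagonal r * diagonal (fun i => (d i)⁻¹) * diagonal r) * Uᵀ := by
            rw [hjW]; simp only [transpose_mul, mul_assoc, diagonal_transpose]
        _ = 1 := by
            rw [diagonal_mul_diagonal, diagonal_mul_diagonal]
            have : (fun i => r i * (d i)⁻¹ * r i) = fun _ => (1 : ℝ) := by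
              ext i; rw [hrr i]; field_simp [(hrp i).ne']
            rw [this, diagonal_one, mul_one, h1]
    have e2 : j * (g⁻¹ * (p * pᵀ) * (g⁻¹)ᵀ) * jᵀ = 1 := by
      calc j * (g⁻¹ * (p * pᵀ) * (g⁻¹)ᵀ) * jᵀ
          = (p⁻¹ * (g * g⁻¹) * p) * (p⁻¹ * (g * g⁻¹) * p)ᵀ := by
            simp only [hj, transpose_mul, mul_assoc]
        _ = 1 := by rw [unit_mul_inv hg, mul_one, unit_inv_mul hp]; simp
    have e3 := e1.trans e2.symm
    exact (hju.mul_left_cancel ((unit_transpose hju).mul_right_cancel e3)).symm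
  rw [hinv, cfc_udu W hWW', h3, cfc_udu U h1]
  calc g * (W * diagonal (fun i => Real.log (d i)⁻¹) * Wᵀ) * gᵀ
      = p * ((j * W) * diagonal (fun i => Real.log (d i)⁻¹) * (j * W)ᵀ) * pᵀ := by
        rw [hgj]; simp only [transpose_mul, mul_assoc]
    _ = p * (U * (diagonal r * diagonal (fun i => Real.log (d i)⁻¹) * diagonal r) * Uᵀ) * pᵀ := by
        rw [hjW]; simp only [transpose_mul, mul_assoc, diagonal_transpose]
    _ = _ := by
        rw [diagonal_mul_diagonal, diagonal_mul_diagonal]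
        have : (fun i => r i * Real.log (d i)⁻¹ * r i) = fun i => -(d i * Real.log (d i)) := by
          ext i
          calc r i * Real.log (d i)⁻¹ * r i = -((r i * r i) * Real.log (d i)) := by
                rw [Real.log_inv]; ring
            _ = _ := by rw [← hrr i]
        have e : diagonal (fun i => -(d i * Real.log (d i)))
            = -diagonal (fun i => d i * Real.log (d i)) := by rw [← diagonal_neg]
        rw [this, e]
        simp only [mul_neg, neg_mul]

theorem quad_conj (C M : Matrix ι ι ℝ) (v : ι → ℝ) :
    v ⬝ᵥ (C * M * Cᵀ) *ᵥ v = (Cᵀ *ᵥ v) ⬝ᵥ M *ᵥ (Cᵀ *ᵥ v) := by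
  rw [← mulVec_mulVec, ← mulVec_mulVec, dotProduct_mulVec v C, ← mulVec_transpose]

/-- the touching inequality for the relative entropy. -/
theorem touch {g h P : Matrix ι ι ℝ} (hg : IsUnit g) (hh : IsUnit h) (hP : P.PosDef)
    (hle : g * gᵀ ≤ h * hᵀ) (v : ι → ℝ) (hv : (g * gᵀ) *ᵥ v = (h * hᵀ) *ᵥ v) :
    v ⬝ᵥ (g * cfc Real.log (g⁻¹ * P * (g⁻¹)ᵀ) * gᵀ) *ᵥ v
      ≤ v ⬝ᵥ (h * cfc Real.log (h⁻¹ * P * (h⁻¹)ᵀ) * hᵀ) *ᵥ v := by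
  obtain ⟨p, hp, rfl⟩ := exists_factor hP
  rw [entropy_swap hg hp, entropy_swap hh hp, neg_mulVec, neg_mulVec, dotProduct_neg,
    dotProduct_neg, neg_le_neg_iff, quad_conj, quad_conj]
  apply eta_touch (pd_conj (pd_mul_transpose hg) (unit_inv hp))
    (pd_conj (pd_mul_transpose hh) (unit_inv hp)) (conj_le hle _)
  have e : (p⁻¹)ᵀ * pᵀ = 1 := by rw [← transpose_mul, unit_mul_inv hp, transpose_one]
  simp only [mulVec_mulVec, mul_assoc, e, mul_one]
  rw [← mulVec_mulVec, hv, mulVec_mulVec]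

theorem cfc_log_smul {M : Matrix ι ι ℝ} (hM : M.PosDef) {c : ℝ} (hc : 0 < c) :
    cfc Real.log (c • M) = cfc Real.log M + Real.log c • (1 : Matrix ι ι ℝ) := by
  obtain ⟨U, h1, h2, h3⟩ := exists_udu hM.1
  have e : c • M = U * diagonal (fun i => c * hM.1.eigenvalues i) * Uᵀ := by
    conv_lhs => rw [h3]
    rw [← smul_mul_assoc, ← mul_smul_comm, ← diagonal_smul]; rfl
  rw [e, cfc_udu U h1]
  conv_rhs => rw [h3, cfc_udu U h1]
  have e2 : Real.log c • (1 : Matrix ι ι ℝ) = U * diagonal (fun _ => Real.log c) * Uᵀ := by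
    have : diagonal (fun _ : ι => Real.log c) = Real.log c • (1 : Matrix ι ι ℝ) := by
      rw [smul_one_eq_diagonal]
    rw [this, mul_smul_comm, smul_mul_assoc, mul_one, h1]
  rw [e2, ← add_mul, ← mul_add, diagonal_add]
  congr 3; ext i
  rw [Real.log_mul hc.ne' (hM.eigenvalues_pos i).ne', add_comm]

theorem exists_max {M : Matrix ι ι ℝ} [Nonempty ι] (hM : M.PosDef) :
    ∃ (c : ℝ) (u : ι → ℝ), 0 < c ∧ u ≠ 0 ∧ M *ᵥ u = c • u ∧ M ≤ c • (1 : Matrix ι ι ℝ) := by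
  obtain ⟨U, h1, h2, h3⟩ := exists_udu hM.1
  obtain ⟨i0, hi0⟩ := Finite.exists_max hM.1.eigenvalues
  have hcol : Uᵀ *ᵥ (U *ᵥ (Pi.single i0 1)) = Pi.single i0 1 := by
    rw [mulVec_mulVec, h2, one_mulVec]
  refine ⟨hM.1.eigenvalues i0, U *ᵥ (Pi.single i0 1), hM.eigenvalues_pos i0, ?_, ?_, ?_⟩
  · intro h0
    rw [h0, mulVec_zero] at hcol
    have := congrFun hcol i0
    simp at this
  · conv_lhs => rw [h3]
    rw [← mulVec_mulVec, hcol, ← mulVec_mulVec, ← mulVec_smul]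
    congr 1
    ext i
    rw [mulVec_diagonal]
    by_cases h : i = i0
    · subst h; simp
    · simp [h]
  · have e2 : hM.1.eigenvalues i0 • (1 : Matrix ι ι ℝ)
        = U * diagonal (fun _ => hM.1.eigenvalues i0) * Uᵀ := by
      have : diagonal (fun _ : ι => hM.1.eigenvalues i0)
          = hM.1.eigenvalues i0 • (1 : Matrix ι ι ℝ) := by
        rw [smul_one_eq_diagonal]
      rw [this, mul_smul_comm, smul_mul_assoc, mul_one, h1]
    rw [e2]
    have : U * diagonal hM.1.eigenvalues * Uᵀ ≤ U * diagonal (fun _ => hM.1.eigenvalues i0) * Uᵀ := by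
      rw [le_iff_quad (herm_udu _ _) (herm_udu _ _)]
      intro v
      rw [quad_udu, quad_udu]
      exact Finset.sum_le_sum fun i _ => mul_le_mul_of_nonneg_right (hi0 i) (sq_nonneg _)
    rwa [← h3] at this

theorem smul_le_smul_pd {M : Matrix ι ι ℝ} (hM : M.PosSemidef) {a b : ℝ} (h : a ≤ b) :
    a • M ≤ b • M := by
  rw [Matrix.le_iff, ← sub_smul]
  exact hM.smul (sub_nonneg.2 h)

theorem main_ineq {κ : Type*} (s : Finset κ) (hs : s.Nonempty) {g h : Matrix ι ι ℝ}
    (hg : IsUnit g) (hh : IsUnit h) (P R : κ → Matrix ι ι ℝ) (hP : ∀ i ∈ s, (P i).PosDef)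
    (hR : ∀ i ∈ s, (R i).PosDef)
    (hgP : ∑ i ∈ s, cfc Real.log (g⁻¹ * P i * (g⁻¹)ᵀ) = 0)
    (hhR : ∑ i ∈ s, cfc Real.log (h⁻¹ * R i * (h⁻¹)ᵀ) = 0)
    (l : κ → ℝ) (hle : ∀ i ∈ s, P i ≤ Real.exp (l i) • R i) :
    g * gᵀ ≤ Real.exp ((∑ i ∈ s, l i) / s.card) • (h * hᵀ) := by
  rcases isEmpty_or_nonempty ι with hι | hι
  · exact le_of_eq (Subsingleton.elim _ _)
  obtain ⟨c, u, hc, hu0, hu, hmax⟩ := exists_max (pd_conj (pd_mul_transpose hg) (unit_inv hh))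
  have hh' : (h⁻¹)ᵀ * hᵀ = 1 := by rw [← transpose_mul, unit_mul_inv hh, transpose_one]
  have hh'' : hᵀ * (h⁻¹)ᵀ = 1 := by rw [← transpose_mul, unit_inv_mul hh, transpose_one]
  set v := (h⁻¹)ᵀ *ᵥ u with hv
  have hvu : hᵀ *ᵥ v = u := by rw [hv, mulVec_mulVec, hh'', one_mulVec]
  have hXZ : g * gᵀ ≤ c • (h * hᵀ) := by
    have := conj_le hmax h
    have e : h * (h⁻¹ * (g * gᵀ) * (h⁻¹)ᵀ) * hᵀ = g * gᵀ := by
      calc h * (h⁻¹ * (g * gᵀ) * (h⁻¹)ᵀ) * hᵀ = (h * h⁻¹) * (g * gᵀ) * ((h⁻¹)ᵀ * hᵀ) := by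
            simp only [mul_assoc]
        _ = _ := by rw [hh', unit_mul_inv hh, one_mul, mul_one]
    rw [e] at this
    simpa using this
  have hXv : (g * gᵀ) *ᵥ v = c • ((h * hᵀ) *ᵥ v) := by
    have := congrArg (fun w => h *ᵥ w) hu
    rw [← mulVec_mulVec, ← mulVec_mulVec, mulVec_mulVec _ h, unit_mul_inv hh, one_mulVec,
      mulVec_smul] at this
    rw [this, ← mulVec_mulVec, hvu]
  set r := Real.sqrt c with hr
  have hrp : 0 < r := Real.sqrt_pos.2 hc
  have hrr : r * r = c := Real.mul_self_sqrt hc.le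
  have hk : (r • h) * (r • h)ᵀ = c • (h * hᵀ) := by
    rw [transpose_smul, smul_mul_smul_comm, hrr]
  have hku : IsUnit (r • h) := by
    have : r • h = (r • (1 : Matrix ι ι ℝ)) * h := by simp
    rw [this]
    refine IsUnit.mul ?_ hh
    exact IsUnit.of_mul_eq_one (r⁻¹ • (1 : Matrix ι ι ℝ)) (by
      rw [smul_mul_smul_comm, mul_inv_cancel₀ hrp.ne']; simp)
  have hkinv : (r • h)⁻¹ = r⁻¹ • h⁻¹ := by
    apply Matrix.inv_eq_right_inv
    rw [smul_mul_smul_comm, mul_inv_cancel₀ hrp.ne', unit_mul_inv hh, one_smul]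
  have step : ∀ i ∈ s, v ⬝ᵥ (g * cfc Real.log (g⁻¹ * P i * (g⁻¹)ᵀ) * gᵀ) *ᵥ v
      ≤ c * (u ⬝ᵥ (cfc Real.log (h⁻¹ * R i * (h⁻¹)ᵀ)) *ᵥ u) + c * (l i - Real.log c) * (u ⬝ᵥ u) := by
    intro i hi
    have h1 := touch hg hku (hP i hi) (by rw [hk]; exact hXZ) v (by rw [hk, hXv, smul_mulVec])
    refine h1.trans ?_
    have e1 : (r • h)⁻¹ * P i * ((r • h)⁻¹)ᵀ = c⁻¹ • (h⁻¹ * P i * (h⁻¹)ᵀ) := by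
      rw [hkinv, transpose_smul, smul_mul_assoc, smul_mul_smul_comm, ← mul_inv, hrr]
    have pd1 : (h⁻¹ * P i * (h⁻¹)ᵀ).PosDef := pd_conj (hP i hi) (unit_inv hh)
    have pd2 : (h⁻¹ * R i * (h⁻¹)ᵀ).PosDef := pd_conj (hR i hi) (unit_inv hh)
    have h2 : h⁻¹ * P i * (h⁻¹)ᵀ ≤ Real.exp (l i) • (h⁻¹ * R i * (h⁻¹)ᵀ) := by
      have := conj_le (hle i hi) h⁻¹
      rwa [mul_smul_comm, smul_mul_assoc] at this
    have h3 := log_mono pd1 (pd2.smul (Real.exp_pos (l i))) h2 u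
    rw [quad_conj, e1, transpose_smul, smul_mulVec, hvu, cfc_log_smul pd1 (inv_pos.2 hc)]
    rw [cfc_log_smul pd2 (Real.exp_pos _), Real.log_exp] at h3
    simp only [mulVec_smul, smul_dotProduct, dotProduct_smul, smul_eq_mul, add_mulVec,
      dotProduct_add, smul_mulVec, one_mulVec, Real.log_inv] at h3 ⊢
    have h4 := mul_le_mul_of_nonneg_left h3 hc.le
    generalize u ⬝ᵥ cfc Real.log (h⁻¹ * P i * h⁻¹ᵀ) *ᵥ u = x at h4 ⊢
    generalize u ⬝ᵥ cfc Real.log (h⁻¹ * R i * h⁻¹ᵀ) *ᵥ u = y at h4 ⊢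
    generalize u ⬝ᵥ u = w at h4 ⊢
    calc _ = (r * r) * x - (r * r) * Real.log c * w := by ring
      _ ≤ _ := by rw [hrr]; linarith
  have hsum := Finset.sum_le_sum step
  have z1 : ∑ i ∈ s, v ⬝ᵥ (g * cfc Real.log (g⁻¹ * P i * (g⁻¹)ᵀ) * gᵀ) *ᵥ v = 0 := by
    rw [← dotProduct_sum, ← sum_mulVec, ← Finset.sum_mul, ← Finset.mul_sum, hgP]
    simp
  have z2 : ∑ i ∈ s, c * (u ⬝ᵥ (cfc Real.log (h⁻¹ * R i * (h⁻¹)ᵀ)) *ᵥ u) = 0 := by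
    rw [← Finset.mul_sum, ← dotProduct_sum, ← sum_mulVec, hhR]
    simp
  rw [z1, Finset.sum_add_distrib, z2, zero_add, ← Finset.sum_mul, ← Finset.mul_sum,
    Finset.sum_sub_distrib, Finset.sum_const, nsmul_eq_mul] at hsum
  have huu : 0 < u ⬝ᵥ u := by
    have h0 : 0 ≤ u ⬝ᵥ u := Finset.sum_nonneg fun i _ => mul_self_nonneg _
    refine lt_of_le_of_ne h0 (fun h => hu0 (dotProduct_self_eq_zero.1 h.symm))
  have hcard : (0 : ℝ) < s.card := by exact_mod_cast hs.card_pos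
  have hlog : Real.log c ≤ (∑ i ∈ s, l i) / s.card := by
    rw [le_div_iff₀ hcard]
    by_contra hcon
    push Not at hcon
    have : c * ((∑ i ∈ s, l i) - s.card * Real.log c) * (u ⬝ᵥ u) < 0 := by
      apply mul_neg_of_neg_of_pos _ huu
      apply mul_neg_of_pos_of_neg hc
      linarith
    linarith
  refine hXZ.trans (smul_le_smul_pd (pd_mul_transpose hh).posSemidef ?_)
  rwa [← Real.log_le_iff_le_exp hc]

end Part2
section Part3
open scoped MatrixOrder ComplexOrder
set_option linter.unusedSectionVars false

section gen
variable {ι : Type*} [Fintype ι] [DecidableEq ι]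

theorem cfc_conj_orth {M O : Matrix ι ι ℝ} (hM : M.IsHermitian) (hO : O * Oᵀ = 1) (f : ℝ → ℝ) :
    cfc f (O * M * Oᵀ) = O * cfc f M * Oᵀ := by
  obtain ⟨U, h1, h2, h3⟩ := exists_udu hM
  have e : ∀ d : ι → ℝ, O * (U * diagonal d * Uᵀ) * Oᵀ = (O * U) * diagonal d * (O * U)ᵀ := by
    intro d; simp only [transpose_mul, mul_assoc]
  have hOU : (O * U) * (O * U)ᵀ = 1 := by
    rw [transpose_mul, mul_assoc, ← mul_assoc U, h1, one_mul, hO]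
  conv_lhs => rw [h3, e, cfc_udu _ hOU]
  conv_rhs => rw [h3, cfc_udu _ h1, e]

theorem trace_udu (U : Matrix ι ι ℝ) (hU : Uᵀ * U = 1) (d : ι → ℝ) :
    (U * diagonal d * Uᵀ).trace = ∑ i, d i := by
  rw [trace_mul_comm, ← mul_assoc, hU, one_mul, trace_diagonal]

theorem trace_cfc {M : Matrix ι ι ℝ} (hM : M.IsHermitian) (f : ℝ → ℝ) :
    (cfc f M).trace = ∑ i, f (hM.eigenvalues i) := by
  obtain ⟨U, h1, h2, h3⟩ := exists_udu hM
  conv_lhs => rw [h3, cfc_udu _ h1, trace_udu _ h2]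

theorem trace_mul_udu (U V : Matrix ι ι ℝ) (a b : ι → ℝ) :
    ((U * diagonal a * Uᵀ) * (V * diagonal b * Vᵀ)).trace
      = ∑ i, ∑ j, a i * b j * ((Uᵀ * V) i j) ^ 2 := by
  have : ((U * diagonal a * Uᵀ) * (V * diagonal b * Vᵀ)).trace
      = ((diagonal a * (Uᵀ * V)) * (diagonal b * (Uᵀ * V)ᵀ)).trace := by
    rw [show (U * diagonal a * Uᵀ) * (V * diagonal b * Vᵀ)
      = U * (diagonal a * Uᵀ * (V * diagonal b * Vᵀ)) by simp only [mul_assoc], trace_mul_comm]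
    simp only [transpose_mul, transpose_transpose, mul_assoc]
  rw [this, trace]
  refine Finset.sum_congr rfl fun i _ => ?_
  rw [diag_apply, mul_apply]
  refine Finset.sum_congr rfl fun j _ => ?_
  rw [diagonal_mul, diagonal_mul, transpose_apply]
  ring

/-- A quantitative Klein inequality. -/
theorem klein {A B : Matrix ι ι ℝ} (hA : A.IsHermitian) (hB : B.IsHermitian)
    (φ ψ : ℝ → ℝ) (C : ℝ)
    (h : ∀ i j, φ (hA.eigenvalues i) ≤ φ (hB.eigenvalues j)
      + ψ (hB.eigenvalues j) * (hA.eigenvalues i - hB.eigenvalues j)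
      + C * (hA.eigenvalues i - hB.eigenvalues j) ^ 2) :
    (cfc φ A).trace ≤ (cfc φ B).trace + (cfc ψ B * (A - B)).trace
      + C * ((A - B) * (A - B)).trace := by
  obtain ⟨U, hU1, hU2, hU3⟩ := exists_udu hA
  obtain ⟨V, hV1, hV2, hV3⟩ := exists_udu hB
  set a := hA.eigenvalues
  set b := hB.eigenvalues
  have T : ∀ f g : ℝ → ℝ, (cfc f A * cfc g B).trace
      = ∑ i, ∑ j, f (a i) * g (b j) * ((Uᵀ * V) i j) ^ 2 := by
    intro f g
    rw [hU3, hV3, cfc_udu _ hU1, cfc_udu _ hV1, trace_mul_udu]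
  have idA : cfc (fun x : ℝ => x) A = A := by
    conv_lhs => rw [hU3, cfc_udu _ hU1]
    exact hU3.symm
  have idB : cfc (fun x : ℝ => x) B = B := by
    conv_lhs => rw [hV3, cfc_udu _ hV1]
    exact hV3.symm
  have oneA : cfc (fun _ : ℝ => (1 : ℝ)) A = 1 := by
    conv_lhs => rw [hU3, cfc_udu _ hU1]
    rw [diagonal_one, mul_one, hU1]
  have oneB : cfc (fun _ : ℝ => (1 : ℝ)) B = 1 := by
    conv_lhs => rw [hV3, cfc_udu _ hV1]
    rw [diagonal_one, mul_one, hV1]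
  have sqA : cfc (fun x : ℝ => x * x) A = A * A := by
    conv_lhs => rw [hU3, cfc_udu _ hU1]
    conv_rhs => rw [hU3]
    rw [show (U * diagonal a * Uᵀ) * (U * diagonal a * Uᵀ)
      = U * (diagonal a * (Uᵀ * U) * diagonal a) * Uᵀ by simp only [mul_assoc], hU2, mul_one,
      diagonal_mul_diagonal]
  have mulB : ∀ f : ℝ → ℝ, cfc (fun x : ℝ => f x * x) B = cfc f B * B := by
    intro f
    conv_lhs => rw [hV3, cfc_udu _ hV1]
    conv_rhs => rw [hV3, cfc_udu _ hV1]
    rw [show (V * diagonal (fun i => f (b i)) * Vᵀ) * (V * diagonal b * Vᵀ)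
      = V * (diagonal (fun i => f (b i)) * (Vᵀ * V) * diagonal b) * Vᵀ by simp only [mul_assoc],
      hV2, mul_one, diagonal_mul_diagonal]
  have sqB : cfc (fun x : ℝ => x * x) B = B * B := by rw [mulB, idB]
  have t1 := T φ (fun _ => 1)
  have t2 := T (fun _ => 1) φ
  have t3 := T (fun x => x) ψ
  have t4 := T (fun _ => 1) (fun x => ψ x * x)
  have t5 := T (fun x => x * x) (fun _ => 1)
  have t6 := T (fun x => x) (fun x => x)
  have t7 := T (fun _ => 1) (fun x => x * x)
  rw [oneB, mul_one] at t1
  rw [oneA, one_mul] at t2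
  rw [idA, trace_mul_comm] at t3
  rw [oneA, one_mul, mulB] at t4
  rw [oneB, mul_one, sqA] at t5
  rw [idA, idB] at t6
  rw [oneA, one_mul, sqB] at t7
  have e1 : (cfc ψ B * (A - B)).trace = (cfc ψ B * A).trace - (cfc ψ B * B).trace := by
    rw [mul_sub, trace_sub]
  have e2 : ((A - B) * (A - B)).trace = (A * A).trace - 2 * (A * B).trace + (B * B).trace := by
    rw [mul_sub, sub_mul, sub_mul, trace_sub, trace_sub, trace_sub, trace_mul_comm B A]; ring
  rw [e1, e2, t1, t2, t3, t4, t5, t6, t7]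
  have : 0 ≤ ∑ i, ∑ j, (φ (b j) + ψ (b j) * (a i - b j) + C * (a i - b j) ^ 2 - φ (a i))
      * ((Uᵀ * V) i j) ^ 2 := by
    refine Finset.sum_nonneg fun i _ => Finset.sum_nonneg fun j _ => ?_
    exact mul_nonneg (sub_nonneg.2 (h i j)) (sq_nonneg _)
  rw [← sub_nonneg]
  refine this.trans (le_of_eq ?_)
  simp only [Finset.mul_sum, ← Finset.sum_sub_distrib, ← Finset.sum_add_distrib]
  refine Finset.sum_congr rfl fun i _ => Finset.sum_congr rfl fun j _ => ?_
  ring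

theorem scalar_log_sq {b r : ℝ} (hb : 0 < b) (hr : 0 < r) :
    ∃ C : ℝ, 0 ≤ C ∧ ∀ a, r ≤ a → (Real.log a) ^ 2 ≤ (Real.log b) ^ 2
      + (2 * Real.log b / b) * (a - b) + C * (a - b) ^ 2 := by
  have hρ : 0 < r / b := div_pos hr hb
  refine ⟨(2 * |Real.log b| / (r / b) + (1 + 1 / (r / b)) ^ 2) / b ^ 2, by positivity, ?_⟩
  intro a ha
  have ha0 : 0 < a := hr.trans_le ha
  obtain ⟨x, rfl⟩ : ∃ x, a = b * x := ⟨a / b, by field_simp⟩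
  have hx : 0 < x := pos_of_mul_pos_right ha0 hb.le
  have hρx : r / b ≤ x := by rw [div_le_iff₀ hb]; linarith
  set ρ := r / b
  rw [Real.log_mul hb.ne' hx.ne']
  set L := Real.log b
  set y := Real.log x with hy
  have hy1 : y ≤ x - 1 := Real.log_le_sub_one_of_pos hx
  have hy2 : 1 - x⁻¹ ≤ y := Real.one_sub_inv_le_log_of_pos hx
  have hxi : x⁻¹ ≤ 1 / ρ := by rw [one_div]; exact inv_anti₀ hρ hρx
  have hD : 0 < 1 / ρ := by positivity
  have hxx : x * x⁻¹ = 1 := mul_inv_cancel₀ hx.ne'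
  have hxi0 : 0 < x⁻¹ := inv_pos.2 hx
  -- quadratic bound on the remainder
  have q1 : |y - (x - 1)| ≤ (1 / ρ) * (x - 1) ^ 2 := by
    rw [abs_le]
    constructor
    · have : x - 1 - (1 - x⁻¹) = x⁻¹ * (x - 1) ^ 2 := by field_simp
      nlinarith [mul_le_mul_of_nonneg_right hxi (sq_nonneg (x - 1))]
    · have : 0 ≤ (1 / ρ) * (x - 1) ^ 2 := by positivity
      linarith
  have q2 : |y| ≤ (1 + 1 / ρ) * |x - 1| := by
    rcases le_total 1 x with h1 | h1
    · have h0 : 0 ≤ y := Real.log_nonneg h1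
      rw [abs_of_nonneg h0, abs_of_nonneg (by linarith)]
      nlinarith [mul_nonneg hD.le (sub_nonneg.2 h1)]
    · have h0 : y ≤ 0 := Real.log_nonpos hx.le h1
      rw [abs_of_nonpos h0, abs_of_nonpos (by linarith)]
      have : x⁻¹ - 1 = x⁻¹ * (1 - x) := by field_simp
      nlinarith [mul_le_mul_of_nonneg_right hxi (sub_nonneg.2 h1)]
  have q3 : y ^ 2 ≤ (1 + 1 / ρ) ^ 2 * (x - 1) ^ 2 := by
    rw [← sq_abs y, ← sq_abs (x - 1), ← mul_pow]
    exact pow_le_pow_left₀ (abs_nonneg _) q2 2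
  have q4 : 2 * L * (y - (x - 1)) ≤ 2 * |L| / ρ * (x - 1) ^ 2 := by
    calc 2 * L * (y - (x - 1)) ≤ |2 * L * (y - (x - 1))| := le_abs_self _
      _ = 2 * |L| * |y - (x - 1)| := by rw [abs_mul, abs_mul]; norm_num
      _ ≤ 2 * |L| * ((1 / ρ) * (x - 1) ^ 2) := by gcongr
      _ = _ := by ring
  have e1 : 2 * L / b * (b * x - b) = 2 * L * (x - 1) := by field_simp
  have e2 : (2 * |L| / ρ + (1 + 1 / ρ) ^ 2) / b ^ 2 * (b * x - b) ^ 2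
      = (2 * |L| / ρ + (1 + 1 / ρ) ^ 2) * (x - 1) ^ 2 := by field_simp
  rw [e1, e2]
  nlinarith

theorem eig_ge {A : Matrix ι ι ℝ} (hA : A.IsHermitian) {r : ℝ}
    (h : r • (1 : Matrix ι ι ℝ) ≤ A) (i : ι) : r ≤ hA.eigenvalues i := by
  obtain ⟨U, h1, h2, h3⟩ := exists_udu hA
  have hcol : Uᵀ *ᵥ (U *ᵥ (Pi.single i 1)) = Pi.single i (1 : ℝ) := by
    rw [mulVec_mulVec, h2, one_mulVec]
  have q := quad_le h (U *ᵥ (Pi.single i 1))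
  have e : (U *ᵥ (Pi.single i 1)) ⬝ᵥ A *ᵥ (U *ᵥ (Pi.single i 1)) = hA.eigenvalues i := by
    conv_lhs => rw [h3]
    rw [quad_udu, hcol]
    simp [Pi.single_apply]
  have e' : (U *ᵥ (Pi.single i 1)) ⬝ᵥ (r • (1 : Matrix ι ι ℝ)) *ᵥ (U *ᵥ (Pi.single i 1)) = r := by
    have : r • (1 : Matrix ι ι ℝ) = U * diagonal (fun _ => r) * Uᵀ := by
      rw [← smul_one_eq_diagonal, mul_smul_comm, smul_mul_assoc, mul_one, h1]
    rw [this, quad_udu, hcol]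
    simp [Pi.single_apply]
  rw [e, e'] at q
  exact q

theorem exists_lower {M : Matrix ι ι ℝ} (hM : M.PosDef) :
    ∃ r : ℝ, 0 < r ∧ r • (1 : Matrix ι ι ℝ) ≤ M := by
  obtain ⟨U, h1, h2, h3⟩ := exists_udu hM.1
  have : ∃ r : ℝ, 0 < r ∧ ∀ i, r ≤ hM.1.eigenvalues i := by
    rcases isEmpty_or_nonempty ι with hι | hι
    · exact ⟨1, one_pos, fun i => (hι.false i).elim⟩
    · obtain ⟨i0, hi0⟩ := Finite.exists_min hM.1.eigenvalues
      exact ⟨_, hM.eigenvalues_pos i0, hi0⟩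
  obtain ⟨r, hr, hri⟩ := this
  refine ⟨r, hr, ?_⟩
  have e : r • (1 : Matrix ι ι ℝ) = U * diagonal (fun _ => r) * Uᵀ := by
    rw [← smul_one_eq_diagonal, mul_smul_comm, smul_mul_assoc, mul_one, h1]
  have : r • (1 : Matrix ι ι ℝ) ≤ U * diagonal hM.1.eigenvalues * Uᵀ := by
    rw [e, le_iff_quad (herm_udu _ _) (herm_udu _ _)]
    intro v
    rw [quad_udu, quad_udu]
    exact Finset.sum_le_sum fun i _ => mul_le_mul_of_nonneg_right (hri i) (sq_nonneg _)
  rwa [← h3] at this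

theorem trace_sq_zero {H : Matrix ι ι ℝ} (hH : H.IsHermitian) (h : (H * H).trace ≤ 0) : H = 0 := by
  have h1 := herm_iff.1 hH
  have : (Hᴴ * H).trace = 0 := by
    rw [conjTranspose_eq_transpose_of_trivial, h1]
    refine le_antisymm h ?_
    have := (posSemidef_conjTranspose_mul_self H).trace_nonneg
    rwa [conjTranspose_eq_transpose_of_trivial, h1] at this
  exact trace_conjTranspose_mul_self_eq_zero_iff.1 this

theorem herm_cfc (M : Matrix ι ι ℝ) (f : ℝ → ℝ) : (cfc f M).IsHermitian :=
  (cfc_predicate f M : IsSelfAdjoint _)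

/-- The first order condition, in matrix form. -/
theorem first_order {κ : Type*} (s : Finset κ) (M : κ → Matrix ι ι ℝ) (hM : ∀ k ∈ s, (M k).PosDef)
    (hmin : ∀ T : Matrix ι ι ℝ, IsUnit T →
      ∑ k ∈ s, (cfc (fun x => (Real.log x) ^ 2) (M k)).trace
        ≤ ∑ k ∈ s, (cfc (fun x => (Real.log x) ^ 2) (T * M k * Tᵀ)).trace) :
    ∑ k ∈ s, cfc Real.log (M k) = 0 := by
  classical
  set H := ∑ k ∈ s, cfc Real.log (M k) with hHdef
  have hH : H.IsHermitian := by
    rw [hHdef, Matrix.IsHermitian, conjTranspose_sum]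
    exact Finset.sum_congr rfl fun k _ => herm_cfc _ _
  have hHt := herm_iff.1 hH
  apply trace_sq_zero hH
  obtain ⟨U, h1, h2, h3⟩ := exists_udu hH
  set d := hH.eigenvalues
  set T : ℝ → Matrix ι ι ℝ := fun t => 1 - t • H with hT
  have hTt : ∀ t, (T t)ᵀ = T t := fun t => by simp [hT, hHt]
  have hTU : ∀ t, T t = U * diagonal (fun i => 1 - t * d i) * Uᵀ := by
    intro t
    have : diagonal (fun i => 1 - t * d i) = 1 - t • diagonal d := by
      rw [← diagonal_one, ← diagonal_smul, diagonal_sub]; rfl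
    rw [this, mul_sub, sub_mul, mul_one, h1, mul_smul_comm, smul_mul_assoc, ← h3]
  -- small times
  have hsmall : ∀ᶠ t : ℝ in nhdsWithin 0 (Set.Ioi 0), 0 < t ∧ ∀ i, 1 / 2 ≤ 1 - t * d i := by
    refine Filter.Eventually.and self_mem_nhdsWithin ?_
    rw [Filter.eventually_all]
    intro i
    have hc : Filter.Tendsto (fun t : ℝ => 1 - t * d i) (nhdsWithin 0 (Set.Ioi 0)) (nhds 1) := by
      have : Continuous (fun t : ℝ => 1 - t * d i) := by fun_prop
      have := this.tendsto 0
      simp only [zero_mul, sub_zero] at this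
      exact this.mono_left nhdsWithin_le_nhds
    have := hc.eventually (eventually_ge_nhds (show (1 / 2 : ℝ) < 1 by norm_num))
    exact this
  -- constants
  have hconst : ∀ k, ∃ C : ℝ, k ∈ s → ∀ᶠ t : ℝ in nhdsWithin 0 (Set.Ioi 0),
      (cfc (fun x => (Real.log x) ^ 2) (T t * M k * (T t)ᵀ)).trace
        ≤ (cfc (fun x => (Real.log x) ^ 2) (M k)).trace
          + (cfc (fun x => 2 * Real.log x / x) (M k) * (T t * M k * (T t)ᵀ - M k)).trace
          + C * ((T t * M k * (T t)ᵀ - M k) * (T t * M k * (T t)ᵀ - M k)).trace := by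
    intro k
    by_cases hk : k ∈ s
    swap
    · exact ⟨0, fun h => (hk h).elim⟩
    have hMk := hM k hk
    obtain ⟨r, hr, hrM⟩ := exists_lower hMk
    have hr4 : 0 < r / 4 := by positivity
    choose C hC0 hC using fun i => scalar_log_sq (hMk.eigenvalues_pos i) hr4
    refine ⟨∑ i, C i, fun _ => ?_⟩
    filter_upwards [hsmall] with t ht
    have hA : (T t * M k * (T t)ᵀ).IsHermitian := herm_conj hMk.1 _
    have hlow : (r / 4) • (1 : Matrix ι ι ℝ) ≤ T t * M k * (T t)ᵀ := by
      refine le_trans ?_ (conj_le hrM (T t))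
      have e1 : T t * (r • (1 : Matrix ι ι ℝ)) * (T t)ᵀ
          = U * diagonal (fun i => r * (1 - t * d i) ^ 2) * Uᵀ := by
        rw [hTt, mul_smul_comm, smul_mul_assoc, mul_one, hTU]
        rw [show (U * diagonal (fun i => 1 - t * d i) * Uᵀ) * (U * diagonal (fun i => 1 - t * d i) * Uᵀ)
          = U * (diagonal (fun i => 1 - t * d i) * (Uᵀ * U) * diagonal (fun i => 1 - t * d i)) * Uᵀ
          by simp only [mul_assoc], h2, mul_one, diagonal_mul_diagonal, ← smul_mul_assoc,
          ← mul_smul_comm, ← diagonal_smul]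
        congr 3; ext i; simp [sq]
      have e : (r / 4) • (1 : Matrix ι ι ℝ) = U * diagonal (fun _ => r / 4) * Uᵀ := by
        rw [← smul_one_eq_diagonal, mul_smul_comm, smul_mul_assoc, mul_one, h1]
      rw [e1, e, le_iff_quad (herm_udu _ _) (herm_udu _ _)]
      intro v
      rw [quad_udu, quad_udu]
      refine Finset.sum_le_sum fun i _ => mul_le_mul_of_nonneg_right ?_ (sq_nonneg _)
      have := ht.2 i
      have h4 : 1 / 4 ≤ (1 - t * d i) ^ 2 := by nlinarith
      nlinarith
    apply klein hA hMk.1 (fun x => (Real.log x) ^ 2) (fun x => 2 * Real.log x / x)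
    intro i j
    refine (hC j _ (eig_ge hA hlow i)).trans ?_
    have : C j ≤ ∑ i, C i := Finset.single_le_sum (fun i _ => hC0 i) (Finset.mem_univ j)
    nlinarith [mul_le_mul_of_nonneg_right this (sq_nonneg (hA.eigenvalues i - hMk.1.eigenvalues j))]
  choose C hC using hconst
  -- expansion
  set K : κ → ℝ → Matrix ι ι ℝ := fun k t => -(H * M k + M k * H) + t • (H * M k * H) with hK
  have hexp : ∀ k t, T t * M k * (T t)ᵀ - M k = t • K k t := by
    intro k t
    rw [hTt]
    simp only [hT, hK, sub_mul, mul_sub, one_mul, mul_one, smul_add, smul_neg, smul_mul_assoc,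
      mul_smul_comm, smul_sub]
    abel
  set ψ : κ → Matrix ι ι ℝ := fun k => cfc (fun x => 2 * Real.log x / x) (M k) with hψ
  have hψM : ∀ k ∈ s, ψ k * M k = (2 : ℝ) • cfc Real.log (M k) ∧
      M k * ψ k = (2 : ℝ) • cfc Real.log (M k) := by
    intro k hk
    obtain ⟨V, g1, g2, g3⟩ := exists_udu (hM k hk).1
    set b := (hM k hk).1.eigenvalues with hb
    have hbp : ∀ i, 0 < b i := (hM k hk).eigenvalues_pos
    have w1 : ψ k = V * diagonal (fun i => 2 * Real.log (b i) / b i) * Vᵀ := by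
      simp only [hψ]
      conv_lhs => rw [g3]
      rw [cfc_udu _ g1]
    have w2 : (2 : ℝ) • cfc Real.log (M k) = V * diagonal (fun i => 2 * Real.log (b i)) * Vᵀ := by
      conv_lhs => rw [g3]
      rw [cfc_udu _ g1, ← smul_mul_assoc, ← mul_smul_comm, ← diagonal_smul]; rfl
    have w3 : ∀ x y : ι → ℝ, (V * diagonal x * Vᵀ) * (V * diagonal y * Vᵀ)
        = V * diagonal (fun i => x i * y i) * Vᵀ := by
      intro x y
      rw [show (V * diagonal x * Vᵀ) * (V * diagonal y * Vᵀ)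
        = V * (diagonal x * (Vᵀ * V) * diagonal y) * Vᵀ by simp only [mul_assoc], g2, mul_one,
        diagonal_mul_diagonal]
    rw [w2, w1]
    conv_lhs => rw [g3]
    constructor
    · rw [w3]; congr 3; ext i; field_simp [(hbp i).ne']
    · conv_lhs => rw [g3]
      rw [w3]; congr 3; ext i; field_simp [(hbp i).ne']
  have htr : ∀ k ∈ s, (ψ k * K k 0).trace = -4 * (H * cfc Real.log (M k)).trace := by
    intro k hk
    obtain ⟨w1, w2⟩ := hψM k hk
    simp only [hK, zero_smul, add_zero]
    rw [mul_neg, trace_neg, mul_add, trace_add, ← mul_assoc, ← mul_assoc, w1, trace_mul_comm,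
      ← mul_assoc, w2, trace_mul_comm (_ • _) H, mul_smul_comm, trace_smul]
    simp only [smul_eq_mul]; ring
  -- the limit
  set G : ℝ → ℝ := fun t => ∑ k ∈ s, ((ψ k * K k t).trace + t * (C k * (K k t * K k t).trace))
    with hG
  have hGc : Continuous G := by
    have hKc : ∀ k, Continuous (K k) := fun k => by
      simp only [hK]; fun_prop
    simp only [hG]
    refine continuous_finsetSum _ fun k _ => ?_
    have a1 : Continuous fun t => (ψ k * K k t).trace := (continuous_const.matrix_mul (hKc k)).matrix_trace
    have a2 : Continuous fun t => (K k t * K k t).trace := ((hKc k).matrix_mul (hKc k)).matrix_trace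
    fun_prop
  have hG0 : G 0 = -4 * (H * H).trace := by
    simp only [hG, zero_mul, add_zero]
    rw [Finset.sum_congr rfl htr, ← Finset.mul_sum, ← trace_sum, ← Finset.mul_sum]
  have hGpos : ∀ᶠ t : ℝ in nhdsWithin 0 (Set.Ioi 0), 0 ≤ G t := by
    have hall : ∀ᶠ t : ℝ in nhdsWithin 0 (Set.Ioi 0), ∀ k ∈ s, _ :=
      (Filter.eventually_all_finset s).2 (fun k hk => hC k hk)
    filter_upwards [hall, hsmall] with t ht hts
    have hunit : IsUnit (T t) := by
      rw [hTU]
      refine IsUnit.mul (IsUnit.mul (IsUnit.of_mul_eq_one _ h1) ?_) (IsUnit.of_mul_eq_one _ h2)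
      rw [Matrix.isUnit_iff_isUnit_det, det_diagonal, isUnit_iff_ne_zero, Finset.prod_ne_zero_iff]
      intro i _
      have := hts.2 i
      linarith
    have m1 := hmin (T t) hunit
    have m2 := Finset.sum_le_sum ht
    have m3 := m1.trans m2
    rw [Finset.sum_add_distrib, Finset.sum_add_distrib] at m3
    have m4 : 0 ≤ t * G t := by
      have : t * G t = ∑ k ∈ s, (cfc (fun x => 2 * Real.log x / x) (M k) * (T t * M k * (T t)ᵀ - M k)).trace
          + ∑ k ∈ s, C k * ((T t * M k * (T t)ᵀ - M k) * (T t * M k * (T t)ᵀ - M k)).trace := by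
        rw [← Finset.sum_add_distrib, hG, Finset.mul_sum]
        refine Finset.sum_congr rfl fun k _ => ?_
        rw [hexp, mul_smul_comm, smul_mul_smul_comm, trace_smul, trace_smul]
        simp only [smul_eq_mul, hψ]; ring
      rw [this]; linarith
    exact nonneg_of_mul_nonneg_right m4 hts.1
  have := ge_of_tendsto ((hGc.tendsto 0).mono_left nhdsWithin_le_nhds) hGpos
  rw [hG0] at this
  linarith

end gen
end Part3
section Part4
open scoped MatrixOrder ComplexOrder
set_option linter.unusedSectionVars false

theorem mpow_eq_cfc {A : Matrix (Fin n) (Fin n) ℝ} (hA : A.IsHermitian) (t : ℝ) :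
    mpow A t = cfc (fun x : ℝ => x ^ t) A := by
  rw [hA.cfc_eq, Matrix.IsHermitian.cfc, Unitary.conjStarAlgAut_apply, mpow, dif_pos hA]
  rfl

theorem mpow_facts {A : Matrix (Fin n) (Fin n) ℝ} (hA : A.PosDef) :
    (mpow A (1/2))ᵀ = mpow A (1/2) ∧ (mpow A (-(1/2)))ᵀ = mpow A (-(1/2)) ∧
    mpow A (1/2) * mpow A (1/2) = A ∧ mpow A (1/2) * mpow A (-(1/2)) = 1 ∧
    mpow A (-(1/2)) * mpow A (1/2) = 1 := by
  rw [mpow_eq_cfc hA.1, mpow_eq_cfc hA.1]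
  obtain ⟨V, g1, g2, g3⟩ := exists_udu hA.1
  set b := hA.1.eigenvalues with hb
  have hbp : ∀ i, 0 < b i := hA.eigenvalues_pos
  have w3 : ∀ x y : Fin n → ℝ, (V * diagonal x * Vᵀ) * (V * diagonal y * Vᵀ)
      = V * diagonal (fun i => x i * y i) * Vᵀ := by
    intro x y
    rw [show (V * diagonal x * Vᵀ) * (V * diagonal y * Vᵀ)
      = V * (diagonal x * (Vᵀ * V) * diagonal y) * Vᵀ by simp only [mul_assoc], g2, mul_one,
      diagonal_mul_diagonal]
  have e : ∀ t : ℝ, cfc (fun x : ℝ => x ^ t) A = V * diagonal (fun i => b i ^ t) * Vᵀ := by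
    intro t
    conv_lhs => rw [g3]
    rw [cfc_udu _ g1]
  refine ⟨herm_iff.1 (herm_cfc _ _), herm_iff.1 (herm_cfc _ _), ?_, ?_, ?_⟩
  · rw [e, w3]
    conv_rhs => rw [g3]
    congr 3; ext i
    rw [← Real.rpow_add (hbp i)]; norm_num
  · rw [e, e, w3]
    have : (fun i => b i ^ (1/2 : ℝ) * b i ^ (-(1/2) : ℝ)) = fun _ => 1 := by
      ext i; rw [← Real.rpow_add (hbp i)]; norm_num
    rw [this, diagonal_one, mul_one, g1]
  · rw [e, e, w3]
    have : (fun i => b i ^ (-(1/2) : ℝ) * b i ^ (1/2 : ℝ)) = fun _ => 1 := by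
      ext i; rw [← Real.rpow_add (hbp i)]; norm_num
    rw [this, diagonal_one, mul_one, g1]

theorem eigsDesc_eq {M : Matrix (Fin n) (Fin n) ℝ} (hM : M.IsHermitian) (i : Fin n) :
    eigsDesc M i = hM.eigenvalues (Tuple.sort hM.eigenvalues i.rev) := by
  rw [eigsDesc, dif_pos hM]

theorem sum_eigsDesc {M : Matrix (Fin n) (Fin n) ℝ} (hM : M.IsHermitian) (F : ℝ → ℝ) :
    ∑ i, F (eigsDesc M i) = (cfc F M).trace := by
  rw [trace_cfc hM]
  simp only [eigsDesc_eq hM]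
  exact Equiv.sum_comp (Fin.revPerm.trans (Tuple.sort hM.eigenvalues))
    (fun i => F (hM.eigenvalues i))

theorem rdist_sq {g P : Matrix (Fin n) (Fin n) ℝ} (hg : IsUnit g) (hP : P.PosDef) :
    rdist (g * gᵀ) P ^ 2
      = ((Real.log 2)⁻¹) ^ 2 * (cfc (fun x => (Real.log x) ^ 2) (g⁻¹ * P * (g⁻¹)ᵀ)).trace := by
  obtain ⟨f1, f2, f3, f4, f5⟩ := mpow_facts (pd_mul_transpose hg)
  set V := mpow (g * gᵀ) (-(1/2))
  set W := mpow (g * gᵀ) (1/2)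
  have hO : (V * g) * (V * g)ᵀ = 1 := by
    rw [transpose_mul, f2, show V * g * (gᵀ * V) = V * (g * gᵀ) * V by simp only [mul_assoc],
      ← f3, ← mul_assoc, f5, one_mul, f4]
  have e : V * P * V = (V * g) * (g⁻¹ * P * (g⁻¹)ᵀ) * (V * g)ᵀ := by
    rw [transpose_mul, f2]
    rw [show V * g * (g⁻¹ * P * (g⁻¹)ᵀ) * (gᵀ * V) = V * (g * g⁻¹) * P * ((g⁻¹)ᵀ * gᵀ) * V by
      simp only [mul_assoc], ← transpose_mul, unit_mul_inv hg]
    simp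
  have hH : (g⁻¹ * P * (g⁻¹)ᵀ).IsHermitian := herm_conj hP.1 _
  have hVPV : (V * P * V).IsHermitian := by
    have := herm_conj hP.1 V; rwa [f2] at this
  rw [rdist, Real.sq_sqrt (Finset.sum_nonneg fun _ _ => sq_nonneg _)]
  have : ∀ i : Fin n, (Real.logb 2 (eigsDesc (V * P * V) i)) ^ 2
      = ((Real.log 2)⁻¹) ^ 2 * (fun x => (Real.log x) ^ 2) (eigsDesc (V * P * V) i) := by
    intro i; rw [Real.logb]; ring
  rw [Finset.sum_congr rfl fun i _ => this i, ← Finset.mul_sum,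
    sum_eigsDesc hVPV (fun x => (Real.log x) ^ 2)]
  congr 1
  rw [e, cfc_conj_orth hH hO, trace_mul_comm, ← mul_assoc, mul_eq_one_comm.1 hO, one_mul]

theorem karcher {κ : Type*} (s : Finset κ) {Q : Matrix (Fin n) (Fin n) ℝ} (hQ : Q.PosDef)
    (P : κ → Matrix (Fin n) (Fin n) ℝ) (hP : ∀ k, (P k).PosDef)
    (hmin : ∀ q : Matrix (Fin n) (Fin n) ℝ, q.PosDef →
      ∑ k ∈ s, (rdist Q (P k)) ^ 2 ≤ ∑ k ∈ s, (rdist q (P k)) ^ 2) :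
    ∑ k ∈ s, cfc Real.log ((mpow Q (1/2))⁻¹ * P k * ((mpow Q (1/2))⁻¹)ᵀ) = 0 := by
  obtain ⟨f1, f2, f3, f4, f5⟩ := mpow_facts hQ
  set W := mpow Q (1/2)
  have hW : IsUnit W := IsUnit.of_mul_eq_one _ f4
  apply first_order
  · exact fun k _ => pd_conj (hP k) (unit_inv hW)
  intro T hT
  have hWT : IsUnit (W * T⁻¹) := hW.mul (unit_inv hT)
  have h := hmin _ (pd_mul_transpose hWT)
  have e1 : ∀ k, rdist Q (P k) ^ 2 = ((Real.log 2)⁻¹) ^ 2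
      * (cfc (fun x => (Real.log x) ^ 2) (W⁻¹ * P k * (W⁻¹)ᵀ)).trace := fun k => by
    have := rdist_sq hW (hP k)
    rwa [f1, f3] at this
  rw [Finset.sum_congr rfl fun k _ => e1 k, Finset.sum_congr rfl fun k _ => rdist_sq hWT (hP k),
    ← Finset.mul_sum, ← Finset.mul_sum] at h
  have hc : 0 < ((Real.log 2)⁻¹) ^ 2 := by
    have := Real.log_pos (show (1:ℝ) < 2 by norm_num)
    positivity
  have h' := le_of_mul_le_mul_left h hc
  refine h'.trans (le_of_eq (Finset.sum_congr rfl fun k _ => ?_))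
  have : (W * T⁻¹)⁻¹ = T * W⁻¹ := by
    rw [Matrix.mul_inv_rev, nonsing_inv_nonsing_inv _ ((Matrix.isUnit_iff_isUnit_det T).1 hT)]
  rw [this, transpose_mul]
  simp only [mul_assoc]

end Part4
section Part5
open scoped MatrixOrder ComplexOrder
set_option linter.unusedSectionVars false

/-- The increasing enumeration of a `k`-subset. -/
def cemb {k : ℕ} (I : Set.powersetCard (Fin n) k) : Fin k ↪o Fin n :=
  Set.powersetCard.ofFinEmbEquiv.symm I

/-- The `k`-th compound matrix. -/
def Lam (k : ℕ) (A : Matrix (Fin n) (Fin n) ℝ) :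
    Matrix (Set.powersetCard (Fin n) k) (Set.powersetCard (Fin n) k) ℝ :=
  Matrix.of fun I J => (A.submatrix (cemb I) (cemb J)).det

theorem Lam_eq (k : ℕ) (A : Matrix (Fin n) (Fin n) ℝ) :
    Lam k A = LinearMap.toMatrix ((Pi.basisFun ℝ (Fin n)).exteriorPower k)
      ((Pi.basisFun ℝ (Fin n)).exteriorPower k) (exteriorPower.map k (Matrix.toLin' A)) := by
  ext I J
  rw [LinearMap.toMatrix_apply, exteriorPower.basis_apply, exteriorPower.basis_repr_apply,
    exteriorPower.map_apply_ιMulti_family, exteriorPower.ιMulti_family,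
    exteriorPower.ιMultiDual_apply_ιMulti]
  rw [Lam, of_apply, ← det_transpose]
  congr 1
  ext a b
  simp [cemb]

theorem Lam_mul (k : ℕ) (A B : Matrix (Fin n) (Fin n) ℝ) :
    Lam k (A * B) = Lam k A * Lam k B := by
  rw [Lam_eq, Lam_eq, Lam_eq, ← LinearMap.toMatrix_comp, Matrix.toLin'_mul,
    exteriorPower.map_comp]

theorem Lam_one (k : ℕ) : Lam k (1 : Matrix (Fin n) (Fin n) ℝ) = 1 := by
  rw [Lam_eq, Matrix.toLin'_one, exteriorPower.map_id, LinearMap.toMatrix_id]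

theorem Lam_transpose (k : ℕ) (A : Matrix (Fin n) (Fin n) ℝ) : Lam k Aᵀ = (Lam k A)ᵀ := by
  ext I J
  simp only [Lam, of_apply, transpose_apply]
  rw [← det_transpose]
  rfl

theorem Lam_diagonal (k : ℕ) (d : Fin n → ℝ) :
    Lam k (diagonal d) = diagonal (fun I => ∏ a, d (cemb I a)) := by
  ext I J
  by_cases h : I = J
  · subst h
    simp only [Lam, of_apply, diagonal_apply_eq]
    rw [submatrix_diagonal _ _ (cemb I).injective, det_diagonal]
    rfl
  · rw [diagonal_apply_ne _ h]
    simp only [Lam, of_apply]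
    obtain ⟨i, his, hit⟩ := (Set.powersetCard.exists_mem_notMem_iff_ne I J).mp h
    obtain ⟨a, rfl⟩ := (Set.powersetCard.mem_range_ofFinEmbEquiv_symm_iff_mem I i).mpr his
    apply Matrix.det_eq_zero_of_row_eq_zero a
    intro b
    rw [submatrix_apply, diagonal_apply_ne]
    intro hh
    apply hit
    rw [← Set.powersetCard.mem_range_ofFinEmbEquiv_symm_iff_mem]
    exact ⟨b, hh.symm⟩

theorem Lam_unit (k : ℕ) {A : Matrix (Fin n) (Fin n) ℝ} (hA : IsUnit A) : IsUnit (Lam k A) := by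
  refine IsUnit.of_mul_eq_one (Lam k A⁻¹) ?_
  rw [← Lam_mul, unit_mul_inv hA, Lam_one]

theorem Lam_inv (k : ℕ) {A : Matrix (Fin n) (Fin n) ℝ} (hA : IsUnit A) :
    Lam k A⁻¹ = (Lam k A)⁻¹ := by
  symm
  apply Matrix.inv_eq_right_inv
  rw [← Lam_mul, unit_mul_inv hA, Lam_one]

theorem Lam_pd (k : ℕ) {A : Matrix (Fin n) (Fin n) ℝ} (hA : A.PosDef) : (Lam k A).PosDef := by
  obtain ⟨p, hp, rfl⟩ := exists_factor hA
  rw [Lam_mul, Lam_transpose]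
  exact pd_mul_transpose (Lam_unit k hp)

theorem Lam_udu (k : ℕ) (U : Matrix (Fin n) (Fin n) ℝ) (d : Fin n → ℝ) :
    Lam k (U * diagonal d * Uᵀ)
      = Lam k U * diagonal (fun I => ∏ a, d (cemb I a)) * (Lam k U)ᵀ := by
  rw [Lam_mul, Lam_mul, Lam_transpose, Lam_diagonal]

open scoped Matrix.Norms.Elementwise in
theorem exists_dLam (k : ℕ) : ∃ D : Matrix (Fin n) (Fin n) ℝ →
      Matrix (Set.powersetCard (Fin n) k) (Set.powersetCard (Fin n) k) ℝ,
    (∀ (κ : Type) (s : Finset κ) (H : κ → Matrix (Fin n) (Fin n) ℝ),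
      D (∑ i ∈ s, H i) = ∑ i ∈ s, D (H i)) ∧
    ∀ (U : Matrix (Fin n) (Fin n) ℝ) (d : Fin n → ℝ), U * Uᵀ = 1 →
      D (U * diagonal d * Uᵀ)
        = Lam k U * diagonal (fun I => ∑ a, d (cemb I a)) * (Lam k U)ᵀ := by
  have hent : ∀ i j, Differentiable ℝ (fun A : Matrix (Fin n) (Fin n) ℝ => A i j) := fun i j =>
    (LinearMap.toContinuousLinearMap (Matrix.entryLinearMap ℝ ℝ i j)).differentiable
  have hF : ∀ I J : Set.powersetCard (Fin n) k,
      Differentiable ℝ (fun A : Matrix (Fin n) (Fin n) ℝ => Lam k A I J) := by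
    intro I J
    simp only [Lam, of_apply, det_apply, submatrix_apply]
    fun_prop
  refine ⟨fun H => Matrix.of fun I J =>
    fderiv ℝ (fun A : Matrix (Fin n) (Fin n) ℝ => Lam k A I J) 1 H, ?_, ?_⟩
  · intro κ s H
    ext I J
    rw [Matrix.sum_apply]
    simp only [of_apply, map_sum]
  · intro U d hU
    ext I J
    simp only [of_apply]
    set H := U * diagonal d * Uᵀ with hH
    have h1 : HasDerivAt (fun t : ℝ => Lam k (1 + t • H) I J)
        (fderiv ℝ (fun A : Matrix (Fin n) (Fin n) ℝ => Lam k A I J) 1 H) 0 := by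
      have hl : HasDerivAt (fun t : ℝ => (1 : Matrix (Fin n) (Fin n) ℝ) + t • H) H 0 := by
        have := ((hasDerivAt_id (0:ℝ)).smul_const H).const_add (1 : Matrix (Fin n) (Fin n) ℝ)
        rw [one_smul] at this
        exact this
      have hf := ((hF I J) (1 + (0:ℝ) • H)).hasFDerivAt
      have := hf.comp_hasDerivAt (0:ℝ) hl
      rw [zero_smul, add_zero] at this
      exact this
    have h2 : HasDerivAt (fun t : ℝ => Lam k (1 + t • H) I J)
        ((Lam k U * diagonal (fun I => ∑ a, d (cemb I a)) * (Lam k U)ᵀ :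
          Matrix (Set.powersetCard (Fin n) k) (Set.powersetCard (Fin n) k) ℝ) I J) 0 := by
      have e : ∀ t : ℝ, 1 + t • H = U * diagonal (fun i => 1 + t * d i) * Uᵀ := by
        intro t
        have : diagonal (fun i => 1 + t * d i) = 1 + t • diagonal d := by
          rw [← diagonal_one, ← diagonal_smul, diagonal_add]; rfl
        rw [this, mul_add, add_mul, mul_one, hU, mul_smul_comm, smul_mul_assoc]
      have e2 : ∀ f : Set.powersetCard (Fin n) k → ℝ,
          (Lam k U * diagonal f * (Lam k U)ᵀ :
            Matrix (Set.powersetCard (Fin n) k) (Set.powersetCard (Fin n) k) ℝ) I J = ∑ K, Lam k U I K * Lam k U J K * f K := by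
        intro f
        rw [mul_apply]
        refine Finset.sum_congr rfl fun K _ => ?_
        rw [mul_diagonal, transpose_apply]; ring
      have e3 : (fun t : ℝ => Lam k (1 + t • H) I J)
          = fun t => ∑ K, Lam k U I K * Lam k U J K * ∏ a, (1 + t * d (cemb K a)) := by
        ext t
        rw [e, Lam_udu, e2]
      rw [e3, e2]
      apply HasDerivAt.fun_sum
      intro K _
      apply HasDerivAt.const_mul
      have := HasDerivAt.fun_finsetProd (u := (Finset.univ : Finset (Fin k))) (x := (0:ℝ))
        (f := fun a t => 1 + t * d (cemb K a)) (f' := fun a => d (cemb K a)) (fun a _ => by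
          have := ((hasDerivAt_id (0:ℝ)).mul_const (d (cemb K a))).const_add 1
          simpa using this)
      simpa using this
    exact h1.unique h2

theorem Lam_karcher (k : ℕ) (s : Finset ℕ) (M : ℕ → Matrix (Fin n) (Fin n) ℝ)
    (hM : ∀ i ∈ s, (M i).PosDef) (h : ∑ i ∈ s, cfc Real.log (M i) = 0) :
    ∑ i ∈ s, cfc Real.log (Lam k (M i)) = 0 := by
  obtain ⟨D, hD1, hD2⟩ := exists_dLam (n := n) k
  have h0 : D 0 = 0 := by
    have := hD1 ℕ ∅ (fun _ => 0)
    simpa using this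
  rw [← h0, ← h, hD1]
  refine Finset.sum_congr rfl fun i hi => ?_
  obtain ⟨U, h1, h2, h3⟩ := exists_udu (hM i hi).1
  have hp := (hM i hi).eigenvalues_pos
  have hLU : Lam k U * (Lam k U)ᵀ = 1 := by rw [← Lam_transpose, ← Lam_mul, h1, Lam_one]
  conv_lhs => rw [h3, Lam_udu, cfc_udu _ hLU]
  conv_rhs => rw [h3, cfc_udu _ h1, hD2 _ _ h1]
  congr 3
  ext I
  exact Real.log_prod (fun a _ => (hp _).ne')

end Part5
section Part6
open scoped MatrixOrder ComplexOrder
set_option linter.unusedSectionVars false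

theorem switch {ι : Type*} [Fintype ι] [DecidableEq ι] {M : Matrix ι ι ℝ} {c : ℝ} (hc : 0 < c)
    (h : Mᵀ * M ≤ c • (1 : Matrix ι ι ℝ)) : M * Mᵀ ≤ c • (1 : Matrix ι ι ℝ) := by
  have h1 := conj_le h M
  rw [Matrix.le_iff] at h1 ⊢
  have h2 : ((c • 1 - M * Mᵀ) * (c • 1 - M * Mᵀ)ᵀ).PosSemidef := by
    have := posSemidef_self_mul_conjTranspose (c • 1 - M * Mᵀ)
    rwa [conjTranspose_eq_transpose_of_trivial] at this
  have h3 := (h1.add h2).smul (inv_pos.2 hc).le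
  convert h3 using 1
  have ht : (c • (1 : Matrix ι ι ℝ) - M * Mᵀ)ᵀ = c • 1 - M * Mᵀ := by
    simp
  rw [ht]
  have : M * (c • (1 : Matrix ι ι ℝ)) * Mᵀ - M * (Mᵀ * M) * Mᵀ
      + (c • 1 - M * Mᵀ) * (c • 1 - M * Mᵀ) = c • (c • 1 - M * Mᵀ) := by
    simp only [mul_sub, sub_mul, smul_mul_assoc, mul_smul_comm, mul_one, one_mul, mul_assoc, smul_sub]
    abel
  rw [this, smul_smul, inv_mul_cancel₀ hc.ne', one_smul]

theorem eigsDesc_antitone {M : Matrix (Fin n) (Fin n) ℝ} (hM : M.IsHermitian) :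
    Antitone (eigsDesc M) := by
  intro i j hij
  rw [eigsDesc_eq hM, eigsDesc_eq hM]
  exact Tuple.monotone_sort hM.eigenvalues (Fin.rev_le_rev.2 hij)

theorem eigsDesc_pos {M : Matrix (Fin n) (Fin n) ℝ} (hM : M.PosDef) (i : Fin n) :
    0 < eigsDesc M i := by
  rw [eigsDesc_eq hM.1]
  exact hM.eigenvalues_pos _

theorem exists_udu_desc {M : Matrix (Fin n) (Fin n) ℝ} (hM : M.IsHermitian) :
    ∃ U : Matrix (Fin n) (Fin n) ℝ, U * Uᵀ = 1 ∧ Uᵀ * U = 1 ∧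
      M = U * diagonal (eigsDesc M) * Uᵀ := by
  obtain ⟨U, h1, h2, h3⟩ := exists_udu hM
  set e : Equiv.Perm (Fin n) := Fin.revPerm.trans (Tuple.sort hM.eigenvalues) with he
  have hd : eigsDesc M = hM.eigenvalues ∘ e := by
    ext i; rw [eigsDesc_eq hM]; rfl
  have k1 : U.submatrix id e * (U.submatrix id e)ᵀ = 1 := by
    rw [transpose_submatrix, submatrix_mul_equiv, h1, submatrix_id_id]
  refine ⟨U.submatrix id e, k1, mul_eq_one_comm.1 k1, ?_⟩
  rw [hd, ← submatrix_diagonal_equiv, transpose_submatrix, submatrix_mul_equiv, submatrix_mul_equiv,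
    submatrix_id_id, ← h3]

theorem sum_filter_lt {k : ℕ} (hk : k ≤ n) (f : Fin n → ℝ) :
    ∑ i ∈ Finset.univ.filter (fun i : Fin n => (i : ℕ) < k), f i
      = ∑ a : Fin k, f (Fin.castLE hk a) := by
  symm
  refine Finset.sum_bij (fun a _ => Fin.castLE hk a) ?_ ?_ ?_ ?_
  · intro a _; simp
  · intro a _ b _ h; simpa using h
  · intro b hb
    simp only [Finset.mem_filter, Finset.mem_univ, true_and] at hb
    exact ⟨⟨b, hb⟩, Finset.mem_univ _, rfl⟩
  · intro a _; rfl

theorem pd_tmul {g : Matrix (Fin n) (Fin n) ℝ} (hg : IsUnit g) : (gᵀ * g).PosDef := by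
  have := pd_mul_transpose (unit_transpose hg)
  rwa [transpose_transpose] at this

theorem psum_sigma {g : Matrix (Fin n) (Fin n) ℝ} (hg : IsUnit g) {k : ℕ} (hk : k ≤ n) :
    psum (sigmaVec g) k
      = (2 * Real.log 2)⁻¹ * Real.log (∏ a : Fin k, eigsDesc (gᵀ * g) (Fin.castLE hk a)) := by
  have hp := eigsDesc_pos (pd_tmul hg)
  rw [psum, sum_filter_lt hk, Real.log_prod (fun a _ => (hp _).ne'), Finset.mul_sum]
  refine Finset.sum_congr rfl fun a _ => ?_
  rw [sigmaVec, svals, Real.logb, Real.log_sqrt (hp _).le]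
  ring

theorem psum_sigma_total {g : Matrix (Fin n) (Fin n) ℝ} (hg : IsUnit g) :
    psum (sigmaVec g) n = (Real.log 2)⁻¹ * Real.log |g.det| := by
  have hp := pd_tmul hg
  rw [psum_sigma hg le_rfl]
  have : ∏ a : Fin n, eigsDesc (gᵀ * g) (Fin.castLE le_rfl a) = |g.det| ^ 2 := by
    rw [sq_abs, sq]
    have h := hp.1.det_eq_prod_eigenvalues
    rw [det_mul, det_transpose] at h
    rw [h]
    simp only [Fin.castLE_rfl, id, eigsDesc_eq hp.1]
    exact Equiv.prod_comp (Fin.revPerm.trans (Tuple.sort hp.1.eigenvalues))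
      (fun i => hp.1.eigenvalues i)
  rw [this, Real.log_pow]
  push_cast
  rw [mul_inv]; ring

theorem psum_const_mul (c : ℝ) (f : Fin n → ℝ) (k : ℕ) :
    psum (fun i => c * f i) k = c * psum f k := by
  rw [psum, psum, Finset.mul_sum]

theorem Lam_tmul (k : ℕ) (g : Matrix (Fin n) (Fin n) ℝ) :
    Lam k (gᵀ * g) = (Lam k g)ᵀ * Lam k g := by rw [Lam_mul, Lam_transpose]

theorem Lam_le_top {M : Matrix (Fin n) (Fin n) ℝ} (hM : M.PosDef) {k : ℕ} (hk : k ≤ n) :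
    Lam k M ≤ (∏ a : Fin k, eigsDesc M (Fin.castLE hk a)) • 1 := by
  obtain ⟨U, h1, h2, h3⟩ := exists_udu_desc hM.1
  have hLU : Lam k U * (Lam k U)ᵀ = 1 := by rw [← Lam_transpose, ← Lam_mul, h1, Lam_one]
  set c := ∏ a : Fin k, eigsDesc M (Fin.castLE hk a) with hc
  have e : c • (1 : Matrix (Set.powersetCard (Fin n) k) (Set.powersetCard (Fin n) k) ℝ)
      = Lam k U * diagonal (fun _ => c) * (Lam k U)ᵀ := by
    rw [← smul_one_eq_diagonal, mul_smul_comm, smul_mul_assoc, mul_one, hLU]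
  have e' : Lam k M
      = Lam k U * diagonal (fun I => ∏ a, eigsDesc M (cemb I a)) * (Lam k U)ᵀ := by
    conv_lhs => rw [h3, Lam_udu]
  rw [e, e', le_iff_quad (herm_udu _ _) (herm_udu _ _)]
  intro v
  rw [quad_udu, quad_udu]
  refine Finset.sum_le_sum fun I _ => mul_le_mul_of_nonneg_right ?_ (sq_nonneg _)
  refine Finset.prod_le_prod (fun a _ => (eigsDesc_pos hM _).le) fun a _ => ?_
  apply eigsDesc_antitone hM.1
  rw [Fin.le_def]
  simp only [Fin.val_castLE]
  -- a strictly increasing map dominates the identity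
  have hmono : ∀ m : ℕ, ∀ hm : m < k, m ≤ (cemb I ⟨m, hm⟩ : ℕ) := by
    intro m
    induction m with
    | zero => intro _; exact Nat.zero_le _
    | succ m ih =>
      intro hm
      have := ih (by omega)
      have h' : cemb I ⟨m, by omega⟩ < cemb I ⟨m + 1, hm⟩ :=
        (cemb I).strictMono (by simp [Fin.lt_def])
      rw [Fin.lt_def] at h'
      omega
  exact hmono a a.2

theorem top_le_of_Lam {M : Matrix (Fin n) (Fin n) ℝ} (hM : M.PosDef) {k : ℕ} (hk : k ≤ n) {c : ℝ}
    (h : Lam k M ≤ c • 1) : ∏ a : Fin k, eigsDesc M (Fin.castLE hk a) ≤ c := by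
  obtain ⟨U, h1, h2, h3⟩ := exists_udu_desc hM.1
  have hLU : (Lam k U)ᵀ * Lam k U = 1 := by rw [← Lam_transpose, ← Lam_mul, h2, Lam_one]
  have e' : Lam k M
      = Lam k U * diagonal (fun I => ∏ a, eigsDesc M (cemb I a)) * (Lam k U)ᵀ := by
    conv_lhs => rw [h3, Lam_udu]
  have h4 := conj_le h (Lam k U)ᵀ
  rw [transpose_transpose, mul_smul_comm, smul_mul_assoc, mul_one, hLU, e',
    show ∀ X : Matrix (Set.powersetCard (Fin n) k) (Set.powersetCard (Fin n) k) ℝ,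
      (Lam k U)ᵀ * (Lam k U * X * (Lam k U)ᵀ) * Lam k U
        = ((Lam k U)ᵀ * Lam k U) * X * ((Lam k U)ᵀ * Lam k U) from
      fun X => by simp only [mul_assoc], hLU, one_mul, mul_one] at h4
  set I0 : Set.powersetCard (Fin n) k :=
    Set.powersetCard.ofFinEmbEquiv (Fin.castLEOrderEmb hk) with hI0
  have h5 := quad_le h4 (Pi.single I0 1)
  have hI : ∀ a, cemb I0 a = Fin.castLE hk a := by
    intro a
    simp [cemb, hI0]
  simpa [hI, smul_mulVec] using h5

theorem log_det_sum (s : Finset ℕ) {g : Matrix (Fin n) (Fin n) ℝ} (hg : IsUnit g)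
    (P : ℕ → Matrix (Fin n) (Fin n) ℝ) (hP : ∀ i, (P i).PosDef)
    (h : ∑ i ∈ s, cfc Real.log (g⁻¹ * P i * (g⁻¹)ᵀ) = 0) :
    ∑ i ∈ s, Real.log (P i).det = 2 * s.card * Real.log |g.det| := by
  have hd : g.det ≠ 0 := ((Matrix.isUnit_iff_isUnit_det g).1 hg).ne_zero
  have e : ∀ i, (cfc Real.log (g⁻¹ * P i * (g⁻¹)ᵀ)).trace
      = Real.log (P i).det - 2 * Real.log |g.det| := by
    intro i
    have hp := pd_conj (hP i) (unit_inv hg)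
    rw [trace_cfc hp.1, ← Real.log_prod (fun j _ => (hp.eigenvalues_pos j).ne')]
    have h1 := hp.1.det_eq_prod_eigenvalues
    have h2 : ∏ j, hp.1.eigenvalues j = (g⁻¹ * P i * (g⁻¹)ᵀ).det := h1.symm
    rw [h2, det_mul, det_mul, det_transpose, det_nonsing_inv, Ring.inverse_eq_inv',
      Real.log_mul (mul_ne_zero (inv_ne_zero hd) (hP i).det_pos.ne') (inv_ne_zero hd),
      Real.log_mul (inv_ne_zero hd) (hP i).det_pos.ne', Real.log_inv, Real.log_abs]
    ring
  have h3 := congrArg Matrix.trace h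
  rw [trace_sum, Finset.sum_congr rfl fun i _ => e i, trace_zero, Finset.sum_sub_distrib,
    Finset.sum_const, nsmul_eq_mul] at h3
  linarith

theorem maj_main (m : ℕ) (P : ℕ → Matrix (Fin n) (Fin n) ℝ) {S W h : Matrix (Fin n) (Fin n) ℝ}
    (hS : IsUnit S) (hW : IsUnit W) (hh : IsUnit h) (hP : ∀ i, (P i).PosDef)
    (hP0 : P 0 = 1) (hPN : P (m + 1) = S⁻¹ * (S⁻¹)ᵀ)
    (hKW : ∑ i ∈ Finset.range (m + 1), cfc Real.log (W⁻¹ * P i * (W⁻¹)ᵀ) = 0)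
    (hKh : ∑ i ∈ Finset.range (m + 1), cfc Real.log (h⁻¹ * P (i + 1) * (h⁻¹)ᵀ) = 0) :
    maj (sigmaVec (h⁻¹ * W)) (fun i => (((m + 1 : ℕ) : ℝ))⁻¹ * sigmaVec S i) := by
  have hBu : IsUnit (h⁻¹ * W) := (unit_inv hh).mul hW
  have hl2 : 0 < Real.log 2 := Real.log_pos (by norm_num)
  have hm : (0 : ℝ) < ((m + 1 : ℕ) : ℝ) := by positivity
  refine ⟨?_, ?_⟩
  · intro k hk
    have hk' := hk.le
    rw [psum_const_mul, psum_sigma hBu hk', psum_sigma hS hk']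
    set lam := ∏ a : Fin k, eigsDesc (Sᵀ * S) (Fin.castLE hk' a) with hlam
    have hlam0 : 0 < lam := Finset.prod_pos fun a _ => eigsDesc_pos (pd_tmul hS) _
    -- the compound inequality
    have hSS : Lam k S * (Lam k S)ᵀ ≤ lam • 1 := by
      apply switch hlam0
      rw [← Lam_tmul]
      exact Lam_le_top (pd_tmul hS) hk'
    have hLS := Lam_unit k hS
    have hone : 1 ≤ lam • Lam k (P (m + 1)) := by
      have := conj_le hSS (Lam k S)⁻¹
      rw [mul_smul_comm, smul_mul_assoc, mul_one, ← mul_assoc, unit_inv_mul hLS, one_mul,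
        ← transpose_mul, unit_inv_mul hLS, transpose_one, ← Lam_inv k hS, ← Lam_transpose,
        ← Lam_mul, ← hPN] at this
      exact this
    set R : ℕ → Matrix (Fin n) (Fin n) ℝ := fun i => if i = 0 then P (m + 1) else P i with hR
    have hRpd : ∀ i, (R i).PosDef := fun i => by
      simp only [hR]; split_ifs <;> exact hP _
    have hKR : ∑ i ∈ Finset.range (m + 1), cfc Real.log (h⁻¹ * R i * (h⁻¹)ᵀ) = 0 := by
      rw [← hKh, Finset.sum_range_succ', Finset.sum_range_succ]
      simp [hR]
    have conv : ∀ g M : Matrix (Fin n) (Fin n) ℝ, IsUnit g →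
        Lam k (g⁻¹ * M * (g⁻¹)ᵀ) = (Lam k g)⁻¹ * Lam k M * ((Lam k g)⁻¹)ᵀ := by
      intro g M hg
      rw [Lam_mul, Lam_mul, Lam_transpose, Lam_inv k hg]
    have k1 := Lam_karcher k _ _ (fun i _ => pd_conj (hP i) (unit_inv hW)) hKW
    have k2 := Lam_karcher k _ _ (fun i _ => pd_conj (hRpd i) (unit_inv hh)) hKR
    rw [Finset.sum_congr rfl fun i _ => by rw [conv _ _ hW]] at k1
    rw [Finset.sum_congr rfl fun i _ => by rw [conv _ _ hh]] at k2
    have hmain := main_ineq (Finset.range (m + 1)) ⟨0, by simp⟩ (Lam_unit k hW) (Lam_unit k hh)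
      (fun i => Lam k (P i)) (fun i => Lam k (R i)) (fun i _ => Lam_pd k (hP i))
      (fun i _ => Lam_pd k (hRpd i)) k1 k2 (fun i => if i = 0 then Real.log lam else 0) (by
        intro i _
        by_cases hi : i = 0
        · subst hi
          simp only [hR, if_true, hP0, Lam_one, Real.exp_log hlam0]
          exact hone
        · simp [hR, hi])
    rw [Finset.sum_ite_eq' , if_pos (by simp), Finset.card_range] at hmain
    set c := Real.exp (Real.log lam / ((m + 1 : ℕ) : ℝ)) with hc
    have hc0 : 0 < c := Real.exp_pos _
    have hLh := Lam_unit k hh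
    have hB1 : Lam k (h⁻¹ * W) * (Lam k (h⁻¹ * W))ᵀ ≤ c • 1 := by
      have := conj_le hmain (Lam k h)⁻¹
      rw [mul_smul_comm, smul_mul_assoc, ← mul_assoc (Lam k h)⁻¹ (Lam k h), unit_inv_mul hLh,
        one_mul, ← transpose_mul, unit_inv_mul hLh, transpose_one] at this
      rw [Lam_mul, Lam_inv k hh, transpose_mul]
      simpa only [mul_assoc] using this
    have hB2 : Lam k ((h⁻¹ * W)ᵀ * (h⁻¹ * W)) ≤ c • 1 := by
      rw [Lam_tmul]
      have := switch (M := (Lam k (h⁻¹ * W))ᵀ) hc0 (by rwa [transpose_transpose])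
      rwa [transpose_transpose] at this
    have hfin := top_le_of_Lam (pd_tmul hBu) hk' hB2
    have hlog := Real.log_le_log
      (Finset.prod_pos fun a _ => eigsDesc_pos (pd_tmul hBu) (Fin.castLE hk' a)) hfin
    rw [hc, Real.log_exp] at hlog
    have : (2 * Real.log 2)⁻¹ * Real.log (∏ a : Fin k,
        eigsDesc ((h⁻¹ * W)ᵀ * (h⁻¹ * W)) (Fin.castLE hk' a))
        ≤ (2 * Real.log 2)⁻¹ * (Real.log lam / ((m + 1 : ℕ) : ℝ)) :=
      mul_le_mul_of_nonneg_left hlog (by positivity)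
    refine this.trans (le_of_eq ?_)
    rw [div_eq_mul_inv]; ring
  · rw [psum_const_mul, psum_sigma_total hBu, psum_sigma_total hS]
    have hhd : h.det ≠ 0 := ((Matrix.isUnit_iff_isUnit_det h).1 hh).ne_zero
    have hWd : W.det ≠ 0 := ((Matrix.isUnit_iff_isUnit_det W).1 hW).ne_zero
    have hSd : S.det ≠ 0 := ((Matrix.isUnit_iff_isUnit_det S).1 hS).ne_zero
    have d1 := log_det_sum _ hW P hP hKW
    have d2 := log_det_sum _ hh (fun i => P (i + 1)) (fun i => hP _) hKh
    rw [Finset.sum_range_succ', hP0, det_one, Real.log_one, add_zero, Finset.card_range] at d1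
    rw [Finset.sum_range_succ, d1, Finset.card_range, hPN, det_mul, det_transpose, det_nonsing_inv,
      Ring.inverse_eq_inv', Real.log_mul (inv_ne_zero hSd) (inv_ne_zero hSd), Real.log_inv] at d2
    rw [det_mul, det_nonsing_inv, Ring.inverse_eq_inv', Real.log_abs, Real.log_abs,
      Real.log_mul (inv_ne_zero hhd) hWd, Real.log_inv]
    rw [Real.log_abs, Real.log_abs] at d2
    have : Real.log S.det = ((m + 1 : ℕ) : ℝ) * (-Real.log h.det + Real.log W.det) := by linarith
    rw [this]
    field_simp

end Part6
section Part7
open scoped MatrixOrder ComplexOrder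
set_option linter.unusedSectionVars false

theorem entry_polar {F : Matrix (Fin n) (Fin n) ℝ} (hF : F.IsHermitian) (i j : Fin n) :
    F i j = ((Pi.single i 1 + Pi.single j 1 : Fin n → ℝ) ⬝ᵥ F *ᵥ (Pi.single i 1 + Pi.single j 1)
      - (Pi.single i 1 : Fin n → ℝ) ⬝ᵥ F *ᵥ Pi.single i 1
      - (Pi.single j 1 : Fin n → ℝ) ⬝ᵥ F *ᵥ Pi.single j 1) / 2 := by
  have h : F j i = F i j := by
    have := congrFun (congrFun (herm_iff.1 hF) i) j
    rwa [transpose_apply] at this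
  simp only [mulVec_add, dotProduct_add, add_dotProduct, mulVec_single_one, single_dotProduct,
    one_mul, col_apply, h]
  ring

theorem continuousAt_of_sandwich {X : Type*} [TopologicalSpace X]
    (F : X → Matrix (Fin n) (Fin n) ℝ) (hF : ∀ x, (F x).PosSemidef) (x0 : X)
    (h : ∀ c : ℝ, 1 < c → ∀ᶠ x in nhds x0, F x ≤ c • F x0 ∧ F x0 ≤ c • F x) :
    ContinuousAt F x0 := by
  have hq : ∀ v : Fin n → ℝ, Filter.Tendsto (fun x => v ⬝ᵥ F x *ᵥ v) (nhds x0)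
      (nhds (v ⬝ᵥ F x0 *ᵥ v)) := by
    intro v
    have hq0 : 0 ≤ v ⬝ᵥ F x0 *ᵥ v := (psd_iff.1 (hF x0)).2 v
    set q0 := v ⬝ᵥ F x0 *ᵥ v with hq0d
    rw [Metric.tendsto_nhds]
    intro ε hε
    filter_upwards [h (1 + ε / (q0 + 1)) (by have : 0 < ε / (q0 + 1) := by positivity
                                             linarith)] with x hx
    have a1 := quad_le hx.1 v
    have a2 := quad_le hx.2 v
    rw [smul_mulVec, dotProduct_smul, smul_eq_mul] at a1 a2
    rw [← hq0d] at a1 a2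
    set q := v ⬝ᵥ F x *ᵥ v
    set δ := ε / (q0 + 1) with hδ
    have hδ0 : 0 < δ := by positivity
    have hδε : δ * (q0 + 1) = ε := by rw [hδ]; field_simp
    rw [Real.dist_eq, abs_lt]
    have hb : q ≤ (1 + δ) * q0 := a1
    constructor
    · nlinarith [mul_nonneg hδ0.le (mul_nonneg hδ0.le hq0)]
    · nlinarith
  have : Filter.Tendsto F (nhds x0) (nhds (F x0)) := by
    refine tendsto_pi_nhds.2 fun i => ?_
    refine tendsto_pi_nhds.2 fun j => ?_
    rw [entry_polar (hF x0).1 i j]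
    refine Filter.Tendsto.congr (fun x => (entry_polar (hF x).1 i j).symm) ?_
    exact (((hq _).sub (hq _)).sub (hq _)).div_const 2
  exact this

theorem pd_close {X : Type*} [TopologicalSpace X]
    (P : X → Matrix (Fin n) (Fin n) ℝ) (hPc : Continuous P) (hP : ∀ x, (P x).PosDef) (x0 : X)
    {c : ℝ} (hc : 1 < c) : ∀ᶠ x in nhds x0, P x ≤ c • P x0 ∧ P x0 ≤ c • P x := by
  obtain ⟨r, hr, hrM⟩ := exists_lower (hP x0)
  set S : X → ℝ := fun x => ∑ i, ∑ j, |P x i j - P x0 i j| with hS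
  have hSc : Continuous S := by
    refine continuous_finsetSum _ fun i _ => continuous_finsetSum _ fun j _ => ?_
    exact ((hPc.matrix_elem i j).sub continuous_const).abs
  have hS0 : S x0 = 0 := by simp [hS]
  have hδ : 0 < r * (1 - c⁻¹) := mul_pos hr (sub_pos.2 (inv_lt_one_of_one_lt₀ hc))
  have hev : ∀ᶠ x in nhds x0, S x < r * (1 - c⁻¹) := by
    have := hSc.tendsto x0
    rw [hS0] at this
    exact this.eventually (gt_mem_nhds hδ)
  filter_upwards [hev] with x hx
  have hquad : ∀ v : Fin n → ℝ, |v ⬝ᵥ P x *ᵥ v - v ⬝ᵥ P x0 *ᵥ v| ≤ S x * ∑ i, v i ^ 2 := by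
    intro v
    have e : v ⬝ᵥ P x *ᵥ v - v ⬝ᵥ P x0 *ᵥ v = ∑ i, ∑ j, (P x i j - P x0 i j) * (v i * v j) := by
      simp only [dotProduct, mulVec, Finset.mul_sum, ← Finset.sum_sub_distrib]
      refine Finset.sum_congr rfl fun i _ => Finset.sum_congr rfl fun j _ => ?_
      ring
    rw [e, hS, Finset.sum_mul]
    refine (Finset.abs_sum_le_sum_abs _ _).trans (Finset.sum_le_sum fun i _ => ?_)
    rw [Finset.sum_mul]
    refine (Finset.abs_sum_le_sum_abs _ _).trans (Finset.sum_le_sum fun j _ => ?_)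
    rw [abs_mul]
    refine mul_le_mul_of_nonneg_left ?_ (abs_nonneg _)
    have s1 : v i ^ 2 ≤ ∑ i, v i ^ 2 :=
      Finset.single_le_sum (fun i _ => sq_nonneg (v i)) (Finset.mem_univ i)
    have s2 : v j ^ 2 ≤ ∑ i, v i ^ 2 :=
      Finset.single_le_sum (fun i _ => sq_nonneg (v i)) (Finset.mem_univ j)
    rw [abs_le]
    constructor <;> nlinarith [sq_nonneg (v i - v j), sq_nonneg (v i + v j)]
  have hmain : ∀ v : Fin n → ℝ, v ⬝ᵥ P x *ᵥ v ≤ c * (v ⬝ᵥ P x0 *ᵥ v) ∧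
      v ⬝ᵥ P x0 *ᵥ v ≤ c * (v ⬝ᵥ P x *ᵥ v) := by
    intro v
    have h1 := abs_le.1 (hquad v)
    have h2 := quad_le hrM v
    rw [smul_mulVec, dotProduct_smul, one_mulVec, smul_eq_mul] at h2
    have h3 : v ⬝ᵥ v = ∑ i, v i ^ 2 := by
      simp only [dotProduct, sq]
    rw [h3] at h2
    set s := ∑ i, v i ^ 2
    have hs : 0 ≤ s := Finset.sum_nonneg fun i _ => sq_nonneg _
    set q := v ⬝ᵥ P x *ᵥ v
    set q0 := v ⬝ᵥ P x0 *ᵥ v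
    have hq0 : 0 ≤ q0 := le_trans (by positivity) h2
    have hcpos : 0 < c := by linarith
    set d := c⁻¹ with hd
    have hcd : c * d = 1 := mul_inv_cancel₀ hcpos.ne'
    have hd0 : 0 < d := inv_pos.2 hcpos
    have hd1 : d < 1 := inv_lt_one_of_one_lt₀ hc
    have h4 : S x * s ≤ (1 - d) * q0 := by
      have a : S x * s ≤ r * (1 - d) * s := mul_le_mul_of_nonneg_right hx.le hs
      have b : (1 - d) * (r * s) ≤ (1 - d) * q0 := mul_le_mul_of_nonneg_left h2 (by linarith)
      linarith
    constructor
    · have : 2 - d ≤ c := by nlinarith [sq_nonneg (c - 1)]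
      nlinarith [mul_le_mul_of_nonneg_right this hq0]
    · have h5 : d * q0 ≤ q := by linarith
      have := mul_le_mul_of_nonneg_left h5 hcpos.le
      rw [← mul_assoc, hcd, one_mul] at this
      exact this
  have hherm : ∀ y, (c • P y).IsHermitian := fun y => by
    rw [herm_iff, transpose_smul, herm_iff.1 (hP y).1]
  constructor
  · rw [le_iff_quad (hP x).1 (hherm x0)]
    intro v
    rw [smul_mulVec, dotProduct_smul, smul_eq_mul]
    exact (hmain v).1
  · rw [le_iff_quad (hP x0).1 (hherm x)]
    intro v
    rw [smul_mulVec, dotProduct_smul, smul_eq_mul]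
    exact (hmain v).2

theorem sqrt_le {A B : Matrix (Fin n) (Fin n) ℝ} (hA : A.PosDef) (hB : B.PosDef) {c : ℝ}
    (hc : 0 < c) (h : A ≤ (c ^ 2) • B) : mpow A (1/2) ≤ c • mpow B (1/2) := by
  rw [mpow_eq_cfc hA.1, mpow_eq_cfc hB.1]
  have h1 := rpow_mono hA.posSemidef h (p := 1/2) ⟨by norm_num, by norm_num⟩
  refine h1.trans (le_of_eq ?_)
  obtain ⟨U, k1, k2, k3⟩ := exists_udu hB.1
  have hp := hB.eigenvalues_pos
  conv_lhs => rw [k3, ← smul_mul_assoc, ← mul_smul_comm, ← diagonal_smul, cfc_udu _ k1]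
  conv_rhs => rw [k3, cfc_udu _ k1, ← smul_mul_assoc, ← mul_smul_comm, ← diagonal_smul]
  congr 3
  ext i
  simp only [Pi.smul_apply, smul_eq_mul]
  rw [Real.mul_rpow (by positivity) (hp i).le, ← Real.sqrt_eq_rpow, Real.sqrt_sq hc.le]

theorem mpow_half_psd {A : Matrix (Fin n) (Fin n) ℝ} (hA : A.PosDef) :
    (mpow A (1/2)).PosSemidef := by
  rw [mpow_eq_cfc hA.1]
  obtain ⟨U, k1, k2, k3⟩ := exists_udu hA.1
  rw [psd_iff]
  refine ⟨herm_cfc _ _, fun v => ?_⟩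
  conv_rhs => rw [k3, cfc_udu _ k1, quad_udu]
  exact Finset.sum_nonneg fun i _ =>
    mul_nonneg (Real.rpow_nonneg (hA.eigenvalues_pos i).le _) (sq_nonneg _)

theorem continuous_minv {X : Type*} [TopologicalSpace X] {F : X → Matrix (Fin n) (Fin n) ℝ}
    (hF : Continuous F) (hu : ∀ x, IsUnit (F x)) : Continuous fun x => (F x)⁻¹ := by
  have e : (fun x => (F x)⁻¹) = fun x => ((F x).det)⁻¹ • (F x).adjugate := by
    ext1 x; rw [Matrix.inv_def, Ring.inverse_eq_inv']
  rw [e]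
  exact (hF.matrix_det.inv₀ fun x =>
    ((Matrix.isUnit_iff_isUnit_det _).1 (hu x)).ne_zero).smul hF.matrix_adjugate

theorem continuous_half {X : Type*} [TopologicalSpace X] (N : ℕ) (hN : 1 ≤ N)
    (P : ℕ → X → Matrix (Fin n) (Fin n) ℝ) (hPc : ∀ i, Continuous (P i))
    (hP : ∀ i x, (P i x).PosDef)
    (Q : X → Matrix (Fin n) (Fin n) ℝ) (hQ : ∀ x, (Q x).PosDef)
    (hK : ∀ x, ∑ k ∈ Finset.range N,
      cfc Real.log ((mpow (Q x) (1/2))⁻¹ * P k x * ((mpow (Q x) (1/2))⁻¹)ᵀ) = 0) :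
    Continuous fun x => mpow (Q x) (1/2) := by
  rw [continuous_iff_continuousAt]
  intro x0
  apply continuousAt_of_sandwich (fun x => mpow (Q x) (1/2)) (fun x => mpow_half_psd (hQ x))
  intro c hc
  have hc0 : 0 < c := by linarith
  have hall : ∀ᶠ x in nhds x0, ∀ i ∈ Finset.range N,
      P i x ≤ (c ^ 2) • P i x0 ∧ P i x0 ≤ (c ^ 2) • P i x :=
    (Filter.eventually_all_finset _).2 fun i _ => pd_close (P i) (hPc i) (hP i) x0 (by nlinarith)
  have key : ∀ x y, (∀ i ∈ Finset.range N, P i x ≤ (c ^ 2) • P i y) →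
      mpow (Q x) (1/2) ≤ c • mpow (Q y) (1/2) := by
    intro x y hxy
    apply sqrt_le (hQ x) (hQ y) hc0
    obtain ⟨f1, f2, f3, f4, f5⟩ := mpow_facts (hQ x)
    obtain ⟨g1, g2, g3, g4, g5⟩ := mpow_facts (hQ y)
    have hc2 : Real.exp (Real.log (c ^ 2)) = c ^ 2 := Real.exp_log (by positivity)
    have := main_ineq (Finset.range N) ⟨0, by simp; omega⟩ (IsUnit.of_mul_eq_one _ f4)
      (IsUnit.of_mul_eq_one _ g4) (fun i => P i x) (fun i => P i y) (fun i _ => hP i x)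
      (fun i _ => hP i y) (hK x) (hK y) (fun _ => Real.log (c ^ 2)) (fun i hi => by
        rw [hc2]; exact hxy i hi)
    have hN' : (N : ℝ) ≠ 0 := by positivity
    rw [Finset.sum_const, Finset.card_range, nsmul_eq_mul, mul_div_cancel_left₀ _ hN', hc2, f1, f3,
      g1, g3] at this
    exact this
  filter_upwards [hall] with x hx
  exact ⟨key x x0 fun i hi => (hx i hi).1, key x0 x fun i hi => (hx i hi).2⟩

end Part7
/-- Let `A` be a continuous linear cocycle over a continuous discrete-time
system `Ψ` on a compact metric space `X`. For `N ∈ ℕ`, let `Q(x)` be the unweighted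
barycenter `bar(I, A⁽¹⁾(x)⁻¹ ∗ I, …, A⁽ᴺ⁻¹⁾(x)⁻¹ ∗ I)` in the trace metric (characterized
as the positive definite minimizer of the sum of squared distances), `V(x) = Q(x)^{-1/2}`,
and `ℬ(x) = V(Ψ(x)) 𝒜(x) V(x)⁻¹`. Then `ℬ` is continuous and
`σ⃗(ℬ(x)) ⪯ N⁻¹ σ⃗(A⁽ᴺ⁾(x))` for all `x ∈ X`. -/
theorem statement17 {n : ℕ} {X : Type*} [MetricSpace X] [CompactSpace X]
    (Ψ : X → X) (hΨ : Continuous Ψ)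
    (A : ℕ → X → Matrix (Fin n) (Fin n) ℝ)
    (hA0 : ∀ x, A 0 x = 1)
    (hco : ∀ s t : ℕ, ∀ x, A (s + t) x = A s (Ψ^[t] x) * A t x)
    (hAcont : ∀ t, Continuous (A t)) (hAunit : ∀ t x, IsUnit (A t x))
    (N : ℕ) (hN : 1 ≤ N)
    (Q : X → Matrix (Fin n) (Fin n) ℝ) (hQpd : ∀ x, (Q x).PosDef)
    (hQbar : ∀ x, ∀ q : Matrix (Fin n) (Fin n) ℝ, q.PosDef →
      ∑ k ∈ Finset.range N, (rdist (Q x) ((A k x)⁻¹ * ((A k x)⁻¹)ᵀ)) ^ 2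
        ≤ ∑ k ∈ Finset.range N, (rdist q ((A k x)⁻¹ * ((A k x)⁻¹)ᵀ)) ^ 2)
    (V B : X → Matrix (Fin n) (Fin n) ℝ)
    (hV : ∀ x, V x = mpow (Q x) (-(1/2)))
    (hB : ∀ x, B x = V (Ψ x) * A 1 x * (V x)⁻¹) :
    Continuous B ∧
      ∀ x, maj (sigmaVec (B x)) (fun i => ((N : ℝ))⁻¹ * sigmaVec (A N x) i) := by
  classical
  set P : ℕ → X → Matrix (Fin n) (Fin n) ℝ := fun k x => (A k x)⁻¹ * ((A k x)⁻¹)ᵀ with hPdef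
  have hPpd : ∀ k x, (P k x).PosDef := fun k x => pd_mul_transpose (unit_inv (hAunit k x))
  have hPc : ∀ k, Continuous (P k) := fun k => by
    have := continuous_minv (hAcont k) (hAunit k)
    exact this.matrix_mul this.matrix_transpose
  have hK : ∀ x, ∑ k ∈ Finset.range N,
      cfc Real.log ((mpow (Q x) (1/2))⁻¹ * P k x * ((mpow (Q x) (1/2))⁻¹)ᵀ) = 0 := fun x =>
    karcher _ (hQpd x) (fun k => P k x) (fun k => hPpd k x) (hQbar x)
  set W : X → Matrix (Fin n) (Fin n) ℝ := fun x => mpow (Q x) (1/2) with hWdef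
  have hWc : Continuous W := continuous_half N hN P hPc hPpd Q hQpd hK
  have hWu : ∀ x, IsUnit (W x) := fun x => IsUnit.of_mul_eq_one _ (mpow_facts (hQpd x)).2.2.2.1
  have hVW : ∀ x, V x = (W x)⁻¹ := fun x => by
    rw [hV]
    exact (Matrix.inv_eq_right_inv (mpow_facts (hQpd x)).2.2.2.1).symm
  have hB' : ∀ x, B x = (W (Ψ x))⁻¹ * A 1 x * W x := fun x => by
    rw [hB, hVW, hVW, nonsing_inv_nonsing_inv _ ((Matrix.isUnit_iff_isUnit_det _).1 (hWu x))]
  refine ⟨?_, ?_⟩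
  · have : B = fun x => (W (Ψ x))⁻¹ * A 1 x * W x := funext hB'
    rw [this]
    exact (((continuous_minv hWc hWu).comp hΨ).matrix_mul (hAcont 1)).matrix_mul hWc
  · intro x
    obtain ⟨m, rfl⟩ : ∃ m, N = m + 1 := ⟨N - 1, by omega⟩
    have hA1 := hAunit 1 x
    have hh : IsUnit ((A 1 x)⁻¹ * W (Ψ x)) := (unit_inv hA1).mul (hWu _)
    have hinv : ((A 1 x)⁻¹ * W (Ψ x))⁻¹ = (W (Ψ x))⁻¹ * A 1 x := by
      rw [Matrix.mul_inv_rev, nonsing_inv_nonsing_inv _ ((Matrix.isUnit_iff_isUnit_det _).1 hA1)]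
    have hstep : ∀ i, ((A 1 x)⁻¹ * W (Ψ x))⁻¹ * P (i + 1) x * (((A 1 x)⁻¹ * W (Ψ x))⁻¹)ᵀ
        = (W (Ψ x))⁻¹ * P i (Ψ x) * ((W (Ψ x))⁻¹)ᵀ := by
      intro i
      have h1 : A (i + 1) x = A i (Ψ x) * A 1 x := hco i 1 x
      have h2 : A 1 x * (A (i + 1) x)⁻¹ = (A i (Ψ x))⁻¹ := by
        rw [h1, Matrix.mul_inv_rev, ← mul_assoc, unit_mul_inv hA1, one_mul]
      rw [hinv, transpose_mul]
      simp only [hPdef]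
      rw [show (W (Ψ x))⁻¹ * A 1 x * ((A (i + 1) x)⁻¹ * ((A (i + 1) x)⁻¹)ᵀ)
          * ((A 1 x)ᵀ * ((W (Ψ x))⁻¹)ᵀ)
        = (W (Ψ x))⁻¹ * ((A 1 x * (A (i + 1) x)⁻¹) * (((A (i + 1) x)⁻¹)ᵀ * (A 1 x)ᵀ))
          * ((W (Ψ x))⁻¹)ᵀ by simp only [mul_assoc], ← transpose_mul, h2]
    have hKh : ∑ i ∈ Finset.range (m + 1), cfc Real.log (((A 1 x)⁻¹ * W (Ψ x))⁻¹ * P (i + 1) x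
        * (((A 1 x)⁻¹ * W (Ψ x))⁻¹)ᵀ) = 0 := by
      rw [Finset.sum_congr rfl fun i _ => by rw [hstep i]]
      exact hK (Ψ x)
    have := maj_main m (fun i => P i x) (hAunit (m + 1) x) (hWu x) hh (fun i => hPpd i x)
      (by simp [hPdef, hA0]) rfl (hK x) hKh
    rw [hinv, ← hB'] at this
    exact this
end
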